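/- Let k ≥ 4 and t ≥ 1 be integers. There exists n₀ such that for all n ≥ n₀, any k-uniform hypergraph on vertex set [n] with exactly C(n,k) − C(n−t,k) edges and containing no k-uniform minimal cycle of length 2t+1 consists exactly of all k-subsets of [n] that meet some fixed t-element set S. -/

import Mathlib

/-- A `k`-uniform minimal cycle of length `ℓ`: a cyclic list of `k`-sets such that
consecutive sets (cyclically) intersect in at least one element and
nonconsecutive sets are disjoint. -/
def IsMinimalCycle (k ℓ : ℕ) {n : ℕ} (A : ZMod ℓ → Finset (Fin n)) : Prop :=
  Function.Injective A ∧ (∀ i, (A i).card = k) ∧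
  (∀ i, (A i ∩ A (i + 1)).Nonempty) ∧
  (∀ i j : ZMod ℓ, j ≠ i → j ≠ i + 1 → i ≠ j + 1 → Disjoint (A i) (A j))

section CycleFreeHypergraphs

open Finset

set_option linter.unusedSectionVars false

/-- `H` contains no minimal cycle of length `2t+1`. -/
def CycleFree (k t : ℕ) {n : ℕ} (H : Finset (Finset (Fin n))) : Prop :=
  ¬ ∃ A : ZMod (2 * t + 1) → Finset (Fin n), IsMinimalCycle k (2 * t + 1) A ∧ ∀ i, A i ∈ H

/-- `U` extends to an edge of `H` avoiding any prescribed set of at most `K` further vertices. -/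
def IsKernel {V : Type*} (H : Finset (Finset V)) (K : ℕ) (U : Finset V) : Prop :=
  ∀ W : Finset V, W.card ≤ K → Disjoint W U → ∃ F ∈ H, U ⊆ F ∧ Disjoint F W

theorem isKernel_of_mem {V : Type*} {H : Finset (Finset V)} {K : ℕ} {E : Finset V} (hE : E ∈ H) :
    IsKernel H K E :=
  fun _ _ hd => ⟨E, hE, Subset.rfl, hd.symm⟩

theorem exists_expansion {V : Type*} [DecidableEq V] {H : Finset (Finset V)} {k ℓ K : ℕ}
    (hH : ∀ e ∈ H, e.card = k) (hK : 2 * ℓ * k ≤ K) (U : ℕ → Finset V)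
    (hker : ∀ i < ℓ, IsKernel H K (U i)) (m : ℕ) (hm : m ≤ ℓ) :
    ∃ F : ℕ → Finset V, ∀ i < m, F i ∈ H ∧ U i ⊆ F i ∧
      (∀ j < ℓ, Disjoint (F i) (U j \ U i)) ∧ ∀ j < i, Disjoint (F i) (F j \ U i) := by
  have hU : ∀ i < ℓ, (U i).card ≤ k := fun i hi => by
    obtain ⟨F, hF, hs, -⟩ := hker i hi ∅ (by simp) (by simp)
    exact (card_le_card hs).trans (hH F hF).le
  induction m with
  | zero => exact ⟨fun _ => ∅, by simp⟩
  | succ m ih =>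
    obtain ⟨F, hF⟩ := ih (by omega)
    obtain ⟨E, hE, hs, hd⟩ := hker m hm
      ((((range ℓ).biUnion U) ∪ ((range m).biUnion F)) \ U m) (by
        refine (card_le_card sdiff_subset).trans ((card_union_le _ _).trans ?_)
        have h1 : ((range ℓ).biUnion U).card ≤ ℓ * k := by
          simpa using card_biUnion_le_card_mul (range ℓ) U k (fun i hi => hU i (mem_range.1 hi))
        have h2 : ((range m).biUnion F).card ≤ m * k := by
          simpa using card_biUnion_le_card_mul (range m) F k
            (fun i hi => (hH _ (hF i (mem_range.1 hi)).1).le)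
        have h3 : m * k ≤ ℓ * k := Nat.mul_le_mul_right _ (by omega)
        nlinarith) sdiff_disjoint
    refine ⟨Function.update F m E, fun i hi => ?_⟩
    rcases Nat.lt_succ_iff_lt_or_eq.1 hi with hi | rfl
    · rw [Function.update_of_ne hi.ne]
      refine ⟨(hF i hi).1, (hF i hi).2.1, (hF i hi).2.2.1, fun j hj => ?_⟩
      rw [Function.update_of_ne (by omega)]
      exact (hF i hi).2.2.2 j hj
    · rw [Function.update_self]
      refine ⟨hE, hs, fun j hj => hd.mono_right ?_, fun j hj => ?_⟩
      · exact sdiff_subset_sdiff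
          ((subset_biUnion_of_mem U (mem_range.2 hj)).trans subset_union_left) Subset.rfl
      · rw [Function.update_of_ne (by omega)]
        exact hd.mono_right (sdiff_subset_sdiff
          ((subset_biUnion_of_mem F (mem_range.2 hj)).trans subset_union_right) Subset.rfl)

theorem exists_minimalCycle_of_kernels {n k ℓ K : ℕ} {H : Finset (Finset (Fin n))} (hℓ : 4 ≤ ℓ)
    (hH : ∀ e ∈ H, e.card = k) (hK : 2 * ℓ * k ≤ K) (U : ℕ → Finset (Fin n))
    (hker : ∀ i < ℓ, IsKernel H K (U i))
    (hadj : ∀ i, i + 1 < ℓ → (U i ∩ U (i + 1)).Nonempty)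
    (hlast : (U (ℓ - 1) ∩ U 0).Nonempty)
    (hdis : ∀ i j, i + 1 < j → j < ℓ → ¬ (i = 0 ∧ j + 1 = ℓ) → Disjoint (U i) (U j)) :
    ∃ A : ZMod ℓ → Finset (Fin n), IsMinimalCycle k ℓ A ∧ ∀ i, A i ∈ H := by
  obtain ⟨F, hF⟩ := exists_expansion hH hK U hker ℓ le_rfl
  have : NeZero ℓ := ⟨by omega⟩
  have : Fact (1 < ℓ) := ⟨by omega⟩
  have hval : ∀ i : ZMod ℓ, (i + 1).val = if i.val + 1 = ℓ then 0 else i.val + 1 := by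
    intro i
    have := ZMod.val_lt i
    rw [ZMod.val_add, ZMod.val_one]
    split_ifs with h
    · rw [h, Nat.mod_self]
    · exact Nat.mod_eq_of_lt (by omega)
  have hinter : ∀ i j, i < j → j < ℓ → Disjoint (U i) (U j) → Disjoint (F i) (F j) := by
    intro i j hij hj hd
    rw [disjoint_left] at hd ⊢
    intro a ha ha'
    have h1 := disjoint_left.1 ((hF j hj).2.2.2 i hij) ha'
    have h2 := disjoint_left.1 ((hF i (by omega)).2.2.1 j hj) ha
    simp only [mem_sdiff, not_and, not_not] at h1 h2
    exact hd (h2 (h1 ha)) (h1 ha)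
  have hdisF : ∀ i j : ZMod ℓ, j ≠ i → j ≠ i + 1 → i ≠ j + 1 →
      Disjoint (F i.val) (F j.val) := by
    have key : ∀ i j : ZMod ℓ, i.val < j.val → j ≠ i + 1 → i ≠ j + 1 →
        Disjoint (F i.val) (F j.val) := by
      intro i j hij h1 h2
      have hj := ZMod.val_lt j
      have h1' : j.val ≠ (i + 1).val := fun h => h1 (ZMod.val_injective ℓ h)
      have h2' : i.val ≠ (j + 1).val := fun h => h2 (ZMod.val_injective ℓ h)
      rw [hval] at h1' h2'
      refine hinter _ _ hij hj (hdis _ _ ?_ hj ?_)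
      · split_ifs at h1' <;> omega
      · rintro ⟨h3, h4⟩
        rw [if_pos h4] at h2'
        exact h2' h3
    intro i j h0 h1 h2
    have : i.val ≠ j.val := fun h => h0 (ZMod.val_injective ℓ h).symm
    rcases lt_or_gt_of_ne this with h | h
    · exact key i j h h1 h2
    · exact (key j i h h2 h1).symm
  have hadjF : ∀ i : ZMod ℓ, (F i.val ∩ F (i + 1).val).Nonempty := by
    intro i
    have hi := ZMod.val_lt i
    rw [hval]
    split_ifs with h
    · have : i.val = ℓ - 1 := by omega
      rw [this]
      exact hlast.mono (inter_subset_inter (hF _ (by omega)).2.1 (hF _ (by omega)).2.1)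
    · exact (hadj _ (by omega)).mono
        (inter_subset_inter (hF _ (by omega)).2.1 (hF _ (by omega)).2.1)
  refine ⟨fun i => F i.val, ⟨?_, fun i => hH _ (hF _ (ZMod.val_lt i)).1, hadjF, hdisF⟩,
    fun i => (hF _ (ZMod.val_lt i)).1⟩
  have hsucc : ∀ i : ZMod ℓ, F i.val ≠ F (i + 1).val := by
    intro i h
    have h2 := hadjF (i + 1)
    rw [← h] at h2
    refine (not_disjoint_iff_nonempty_inter.2 h2) (hdisF _ _ ?_ ?_ ?_)
    all_goals
      intro h3
      have h4 := congrArg ZMod.val h3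
      have hi := ZMod.val_lt i
      simp only [hval] at h4
      split_ifs at h4 <;> omega
  intro i j hij
  by_contra hne
  simp only at hij
  by_cases h1 : j = i + 1
  · exact hsucc i (h1 ▸ hij)
  by_cases h2 : i = j + 1
  · exact hsucc j (h2 ▸ hij.symm)
  have h3 := hdisF i j (Ne.symm hne) h1 h2
  rw [← hij, disjoint_self_iff_empty] at h3
  have := hadjF i
  simp [h3] at this

/-- An alternating path `Y 0, X 0, Y 1, …, X (t-1), Y t` of blocks with kernel unions, closed up
by an edge `E`, expands to a minimal cycle of length `2t+1`. -/
theorem not_cycleFree_of_path {n k t K : ℕ} {H : Finset (Finset (Fin n))} (ht : 2 ≤ t)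
    (hH : ∀ e ∈ H, e.card = k) (hK : 2 * (2 * t + 1) * k ≤ K) (X Y : ℕ → Finset (Fin n))
    (hXX : ∀ i < t, ∀ j < i, Disjoint (X i) (X j))
    (hYY : ∀ i ≤ t, ∀ j < i, Disjoint (Y i) (Y j))
    (hXY : ∀ i < t, ∀ j ≤ t, Disjoint (X i) (Y j))
    (hX : ∀ i < t, (X i).Nonempty) (hY : ∀ i ≤ t, (Y i).Nonempty)
    (hker : ∀ i < t, IsKernel H K (Y i ∪ X i) ∧ IsKernel H K (X i ∪ Y (i + 1)))
    {E : Finset (Fin n)} (hE : E ∈ H) (hE0 : Y 0 ⊆ E) (hEt : Y t ⊆ E)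
    (hEX : ∀ i < t, Disjoint E (X i)) (hEY : ∀ i < t, 0 < i → Disjoint E (Y i)) :
    ¬ CycleFree k t H := by
  have hXX' : ∀ i < t, ∀ j < t, i ≠ j → Disjoint (X i) (X j) := by
    intro i hi j hj h
    rcases lt_or_gt_of_ne h with h | h
    · exact (hXX j hj i h).symm
    · exact hXX i hi j h
  have hYY' : ∀ i ≤ t, ∀ j ≤ t, i ≠ j → Disjoint (Y i) (Y j) := by
    intro i hi j hj h
    rcases lt_or_gt_of_ne h with h | h
    · exact (hYY j hj i h).symm
    · exact hYY i hi j h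
  rw [CycleFree, not_not]
  let U : ℕ → Finset (Fin n) := fun i =>
    if i < 2 * t then (if i % 2 = 0 then Y (i / 2) ∪ X (i / 2) else X (i / 2) ∪ Y (i / 2 + 1))
    else E
  have hU0 : ∀ i, i < t → U (2 * i) = Y i ∪ X i := by
    intro i hi
    have h1 : 2 * i < 2 * t := by omega
    have h2 : 2 * i % 2 = 0 := by omega
    have h3 : 2 * i / 2 = i := by omega
    simp [U, h1, h2, h3]
  have hU1 : ∀ i, i < t → U (2 * i + 1) = X i ∪ Y (i + 1) := by
    intro i hi
    have h1 : 2 * i + 1 < 2 * t := by omega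
    have h2 : ¬ (2 * i + 1) % 2 = 0 := by omega
    have h3 : (2 * i + 1) / 2 = i := by omega
    simp only [U, if_pos h1, if_neg h2, h3]
  have hUE : U (2 * t) = E := by simp [U]
  have hcase : ∀ i < 2 * t + 1, (∃ a < t, i = 2 * a) ∨ (∃ a < t, i = 2 * a + 1) ∨ i = 2 * t := by
    intro i hi
    rcases Nat.even_or_odd' i with ⟨a, h | h⟩
    · by_cases ha : a < t
      · exact Or.inl ⟨a, ha, h⟩
      · exact Or.inr (Or.inr (by omega))
    · exact Or.inr (Or.inl ⟨a, by omega, h⟩)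
  refine exists_minimalCycle_of_kernels (by omega) hH hK U ?_ ?_ ?_ ?_
  · intro i hi
    rcases hcase i hi with ⟨a, ha, rfl⟩ | ⟨a, ha, rfl⟩ | rfl
    · rw [hU0 a ha]; exact (hker a ha).1
    · rw [hU1 a ha]; exact (hker a ha).2
    · rw [hUE]; exact isKernel_of_mem hE
  · intro i hi
    rcases hcase i (by omega) with ⟨a, ha, rfl⟩ | ⟨a, ha, rfl⟩ | rfl
    · rw [hU0 a ha, hU1 a ha]
      exact (hX a ha).mono (subset_inter subset_union_right subset_union_left)
    · rw [hU1 a ha]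
      refine (hY (a + 1) (by omega)).mono (subset_inter subset_union_right ?_)
      by_cases h : a + 1 < t
      · rw [show 2 * a + 1 + 1 = 2 * (a + 1) by ring, hU0 _ h]; exact subset_union_left
      · rw [show 2 * a + 1 + 1 = 2 * t by omega, hUE, show a + 1 = t by omega]; exact hEt
    · omega
  · rw [show 2 * t + 1 - 1 = 2 * t by omega, hUE, show U 0 = _ from hU0 0 (by omega)]
    exact (hY 0 (by omega)).mono (subset_inter hE0 subset_union_left)
  · intro i j hij hj hne
    rcases hcase i (by omega) with ⟨a, ha, rfl⟩ | ⟨a, ha, rfl⟩ | rfl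
    · rcases hcase j hj with ⟨b, hb, rfl⟩ | ⟨b, hb, rfl⟩ | rfl
      · rw [hU0 a ha, hU0 b hb, disjoint_union_left, disjoint_union_right, disjoint_union_right]
        exact ⟨⟨hYY' _ (by omega) _ (by omega) (by omega), (hXY _ hb _ (by omega)).symm⟩,
          hXY _ ha _ (by omega), hXX' _ ha _ hb (by omega)⟩
      · rw [hU0 a ha, hU1 b hb, disjoint_union_left, disjoint_union_right, disjoint_union_right]
        exact ⟨⟨(hXY _ hb _ (by omega)).symm, hYY' _ (by omega) _ (by omega) (by omega)⟩,
          hXX' _ ha _ hb (by omega), hXY _ ha _ (by omega)⟩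
      · rw [hU0 a ha, hUE, disjoint_union_left]
        exact ⟨(hEY a ha (by omega)).symm, (hEX a ha).symm⟩
    · rcases hcase j hj with ⟨b, hb, rfl⟩ | ⟨b, hb, rfl⟩ | rfl
      · rw [hU1 a ha, hU0 b hb, disjoint_union_left, disjoint_union_right, disjoint_union_right]
        exact ⟨⟨hXY _ ha _ (by omega), hXX' _ ha _ hb (by omega)⟩,
          hYY' _ (by omega) _ (by omega) (by omega), (hXY _ hb _ (by omega)).symm⟩
      · rw [hU1 a ha, hU1 b hb, disjoint_union_left, disjoint_union_right, disjoint_union_right]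
        exact ⟨⟨hXX' _ ha _ hb (by omega), hXY _ ha _ (by omega)⟩,
          (hXY _ hb _ (by omega)).symm, hYY' _ (by omega) _ (by omega) (by omega)⟩
      · rw [hU1 a ha, hUE, disjoint_union_left]
        exact ⟨(hEX a ha).symm, (hEY (a + 1) (by omega) (by omega)).symm⟩
    · omega

section tuples
variable {ι V : Type*} [Fintype ι] [DecidableEq ι] [DecidableEq V]

/-- The members of `𝓕` which agree with `F` outside the coordinates in `A`. -/
def fiber (𝓕 : Finset (ι → V)) (A : Finset ι) (F : ι → V) : Finset (ι → V) :=
  {F' ∈ 𝓕 | ∀ l ∉ A, F' l = F l}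

theorem mem_fiber {𝓕 : Finset (ι → V)} {A : Finset ι} {F F' : ι → V} :
    F' ∈ fiber 𝓕 A F ↔ F' ∈ 𝓕 ∧ ∀ l ∉ A, F' l = F l := by
  simp [fiber]

theorem exists_clean (𝒜 : Finset (Finset ι)) (D : ℕ) (𝓕 : Finset (ι → V)) :
    ∃ 𝓕' ⊆ 𝓕, ∃ R : Finset ι → Finset (ι → V),
      (∀ A ∈ 𝒜, ∀ F ∈ 𝓕', D ≤ (fiber 𝓕' A F).card) ∧ 𝓕 ⊆ 𝓕' ∪ 𝒜.biUnion R ∧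
      ∀ A, R A ⊆ 𝓕 ∧ ∀ F ∈ R A, (fiber (R A) A F).card ≤ D := by
  induction h : 𝓕.card using Nat.strong_induction_on generalizing 𝓕 with
  | _ m ih =>
  subst h
  by_cases hgood : ∀ A ∈ 𝒜, ∀ F ∈ 𝓕, D ≤ (fiber 𝓕 A F).card
  · exact ⟨𝓕, Subset.rfl, fun _ => ∅, hgood, subset_union_left, by simp⟩
  push Not at hgood
  obtain ⟨A₀, hA₀, F₀, hF₀, hlt⟩ := hgood
  have hss : fiber 𝓕 A₀ F₀ ⊆ 𝓕 := filter_subset _ _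
  have hmem : F₀ ∈ fiber 𝓕 A₀ F₀ := mem_fiber.2 ⟨hF₀, fun _ _ => rfl⟩
  obtain ⟨𝓕', hsub, R, h1, h2, h3⟩ := ih (𝓕 \ fiber 𝓕 A₀ F₀).card
    (card_lt_card (sdiff_ssubset hss ⟨F₀, hmem⟩)) _ rfl
  refine ⟨𝓕', hsub.trans sdiff_subset, Function.update R A₀ (R A₀ ∪ fiber 𝓕 A₀ F₀), h1, ?_, ?_⟩
  · intro F hF
    by_cases hm : F ∈ fiber 𝓕 A₀ F₀
    · refine mem_union_right _ (mem_biUnion.2 ⟨A₀, hA₀, ?_⟩)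
      rw [Function.update_self]
      exact mem_union_right _ hm
    · rcases mem_union.1 (h2 (mem_sdiff.2 ⟨hF, hm⟩)) with h | h
      · exact mem_union_left _ h
      · obtain ⟨A, hA, hFA⟩ := mem_biUnion.1 h
        refine mem_union_right _ (mem_biUnion.2 ⟨A, hA, ?_⟩)
        by_cases hAA : A = A₀
        · subst hAA; rw [Function.update_self]; exact mem_union_left _ hFA
        · rwa [Function.update_of_ne hAA]
  · intro A
    by_cases hAA : A = A₀
    · subst hAA
      rw [Function.update_self]
      refine ⟨union_subset ((h3 A).1.trans sdiff_subset) hss, fun F hF => ?_⟩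
      by_cases hFf : F ∈ fiber 𝓕 A F₀
      · refine (card_le_card fun G hG => ?_).trans hlt.le
        rw [mem_fiber] at hG hFf ⊢
        refine ⟨?_, fun l hl => (hG.2 l hl).trans (hFf.2 l hl)⟩
        exact (union_subset ((h3 A).1.trans sdiff_subset) hss) hG.1
      · have hFR : F ∈ R A := (mem_union.1 hF).resolve_right hFf
        refine (card_le_card fun G hG => ?_).trans ((h3 A).2 F hFR)
        rw [mem_fiber] at hG ⊢
        refine ⟨(mem_union.1 hG.1).resolve_right fun hGf => hFf ?_, hG.2⟩
        rw [mem_fiber] at hGf ⊢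
        exact ⟨sdiff_subset ((h3 A).1 hFR), fun l hl => (hG.2 l hl).symm.trans (hGf.2 l hl)⟩
    · rw [Function.update_of_ne hAA]
      exact ⟨(h3 A).1.trans sdiff_subset, (h3 A).2⟩

theorem card_le_of_card_fiber_le {B : Finset V} {R : Finset (ι → V)} {A : Finset ι} {D : ℕ}
    (hB : ∀ F ∈ R, ∀ i, F i ∈ B) (hR : ∀ F ∈ R, (fiber R A F).card ≤ D) :
    R.card ≤ D * B.card ^ (Fintype.card ι - A.card) := by
  let π : (ι → V) → ({l // l ∉ A} → V) := fun F l => F l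
  have h1 : R.card ≤ D * (R.image π).card := by
    refine card_le_mul_card_image R D fun g hg => ?_
    obtain ⟨F, hF, rfl⟩ := mem_image.1 hg
    refine (card_le_card fun G hG => ?_).trans (hR F hF)
    rw [mem_filter] at hG
    exact mem_fiber.2 ⟨hG.1, fun l hl => congrFun hG.2 ⟨l, hl⟩⟩
  refine h1.trans (Nat.mul_le_mul_left _ ?_)
  have h2 : R.image π ⊆ Fintype.piFinset fun _ => B := by
    intro g hg
    obtain ⟨F, hF, rfl⟩ := mem_image.1 hg
    exact Fintype.mem_piFinset.2 fun l => hB F hF l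
  refine (card_le_card h2).trans ?_
  rw [Fintype.card_piFinset, prod_const, card_univ, Fintype.card_subtype_compl]
  simp

theorem exists_transversal {R : Finset (ι → V)} {A : Finset ι} {D : ℕ}
    (hR : ∀ F ∈ R, (fiber R A F).card ≤ D) :
    ∃ R' ⊆ R, (∀ F ∈ R', ∀ G ∈ R', (∀ l ∉ A, F l = G l) → F = G) ∧ R.card ≤ D * R'.card := by
  let π : (ι → V) → ({l // l ∉ A} → V) := fun F l => F l
  have hch : ∀ g ∈ R.image π, ∃ F ∈ R, π F = g := fun g hg => mem_image.1 hg
  rcases R.eq_empty_or_nonempty with rfl | ⟨F₁, -⟩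
  · exact ⟨∅, by simp⟩
  have : Nonempty (ι → V) := ⟨F₁⟩
  choose! c hc using hch
  refine ⟨(R.image π).image c, fun F hF => ?_, ?_, ?_⟩
  · obtain ⟨g, hg, rfl⟩ := mem_image.1 hF
    exact (hc g hg).1
  · intro F hF G hG h
    obtain ⟨f, hf, rfl⟩ := mem_image.1 hF
    obtain ⟨g, hg, rfl⟩ := mem_image.1 hG
    have : π (c f) = π (c g) := funext fun l => h l l.2
    rw [(hc f hf).2, (hc g hg).2] at this
    rw [this]
  · rw [card_image_of_injOn]
    · refine card_le_mul_card_image R D fun g hg => ?_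
      obtain ⟨F, hF, rfl⟩ := mem_image.1 hg
      refine (card_le_card fun G hG => ?_).trans (hR F hF)
      rw [mem_filter] at hG
      exact mem_fiber.2 ⟨hG.1, fun l hl => congrFun hG.2 ⟨l, hl⟩⟩
    · intro f hf g hg h
      rw [← (hc f hf).2, ← (hc g hg).2]
      simp only [h]

/-- A family with many members has a nonempty subfamily with large fibers in all the
directions `𝒜`. -/
theorem exists_full {B : Finset V} {𝓕 : Finset (ι → V)} (hB : ∀ F ∈ 𝓕, ∀ i, F i ∈ B)
    (𝒜 : Finset (Finset ι)) (D : ℕ)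
    (hcard : D * ∑ A ∈ 𝒜, B.card ^ (Fintype.card ι - A.card) < 𝓕.card) :
    ∃ 𝓕' ⊆ 𝓕, 𝓕'.Nonempty ∧ ∀ A ∈ 𝒜, ∀ F ∈ 𝓕', D ≤ (fiber 𝓕' A F).card := by
  obtain ⟨𝓕', hsub, R, h1, h2, h3⟩ := exists_clean 𝒜 D 𝓕
  refine ⟨𝓕', hsub, ?_, h1⟩
  by_contra hne
  rw [not_nonempty_iff_eq_empty] at hne
  subst hne
  rw [empty_union] at h2
  refine absurd hcard (not_lt.2 ?_)
  refine (card_le_card h2).trans (card_biUnion_le.trans ?_)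
  rw [mul_sum]
  exact sum_le_sum fun A _ =>
    card_le_of_card_fiber_le (fun F hF => hB F ((h3 A).1 hF)) (h3 A).2

/-- Every member of `𝓕` can be modified within `𝓕` on all coordinates in `A`, and nowhere else,
avoiding any set of fewer than `D` vertices. -/
def Movable (𝓕 : Finset (ι → V)) (D : ℕ) (A : Finset ι) : Prop :=
  ∀ F ∈ 𝓕, ∀ W : Finset V, W.card < D → ∃ F' ∈ 𝓕, (∀ i ∉ A, F' i = F i) ∧ ∀ i ∈ A, F' i ∉ W

theorem Movable.union {𝓕 : Finset (ι → V)} {D : ℕ} {A B : Finset ι} (hA : Movable 𝓕 D A)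
    (hB : Movable 𝓕 D B) : Movable 𝓕 D (A ∪ B) := by
  intro F hF W hW
  obtain ⟨F₁, hF₁, h1, h2⟩ := hA F hF W hW
  obtain ⟨F₂, hF₂, h3, h4⟩ := hB F₁ hF₁ W hW
  refine ⟨F₂, hF₂, fun i hi => ?_, fun i hi => ?_⟩
  · rw [mem_union, not_or] at hi
    rw [h3 i hi.2, h1 i hi.1]
  · by_cases hiB : i ∈ B
    · exact h4 i hiB
    · rw [h3 i hiB]
      exact h2 i ((mem_union.1 hi).resolve_right hiB)

theorem movable_empty (𝓕 : Finset (ι → V)) (D : ℕ) : Movable 𝓕 D ∅ :=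
  fun F hF _ _ => ⟨F, hF, by simp⟩

theorem Movable.biUnion {κ : Type*} {𝓕 : Finset (ι → V)} {D : ℕ} (s : Finset κ)
    (f : κ → Finset ι) (h : ∀ a ∈ s, Movable 𝓕 D (f a)) : Movable 𝓕 D (s.biUnion f) := by
  classical
  induction s using Finset.induction_on with
  | empty => simpa using movable_empty 𝓕 D
  | insert a s ha ih =>
    rw [biUnion_insert]
    exact (h a (mem_insert_self _ _)).union (ih fun b hb => h b (mem_insert_of_mem hb))

theorem movable_singleton {𝓕 : Finset (ι → V)} {D : ℕ} {i : ι}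
    (h : ∀ F ∈ 𝓕, D ≤ (fiber 𝓕 {i} F).card) : Movable 𝓕 D {i} := by
  intro F hF W hW
  have hinj : Set.InjOn (fun G : ι → V => G i) (fiber 𝓕 {i} F) := by
    intro G hG G' hG' he
    rw [mem_coe, mem_fiber] at hG hG'
    funext l
    by_cases hl : l = i
    · subst hl; exact he
    · rw [hG.2 l (by simpa using hl), hG'.2 l (by simpa using hl)]
  have : ∃ v ∈ (fiber 𝓕 {i} F).image (fun G : ι → V => G i), v ∉ W := by
    apply exists_mem_notMem_of_card_lt_card
    rw [card_image_of_injOn hinj]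
    exact hW.trans_le (h F hF)
  obtain ⟨v, hv, hvW⟩ := this
  obtain ⟨G, hG, rfl⟩ := mem_image.1 hv
  rw [mem_fiber] at hG
  exact ⟨G, hG.1, hG.2, by simpa using hvW⟩

/-- No two members of `𝓕` differ in coordinate `i` only. -/
def Rigid (𝓕 : Finset (ι → V)) (i : ι) : Prop :=
  ∀ F ∈ 𝓕, ∀ G ∈ 𝓕, (∀ l, l ≠ i → F l = G l) → F = G

theorem movable_pair {𝓕 : Finset (ι → V)} {D : ℕ} {i j : ι} (hi : Rigid 𝓕 i) (hj : Rigid 𝓕 j)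
    (h : ∀ F ∈ 𝓕, 2 * D ≤ (fiber 𝓕 {i, j} F).card) : Movable 𝓕 D {i, j} := by
  intro F hF W hW
  have hbad : ∀ a b : ι, Rigid 𝓕 b →
      ({G ∈ fiber 𝓕 {a, b} F | G a ∈ W}).card ≤ W.card := by
    intro a b hb
    refine card_le_card_of_injOn (fun G => G a) (fun G hG => (mem_filter.1 hG).2) ?_
    intro G hG G' hG' he
    rw [mem_coe, mem_filter, mem_fiber] at hG hG'
    refine hb G hG.1.1 G' hG'.1.1 fun l hl => ?_
    by_cases hla : l = a
    · subst hla; exact he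
    · rw [hG.1.2 l (by simp [hl, hla]), hG'.1.2 l (by simp [hl, hla])]
  have h1 := hbad i j hj
  have h2 := hbad j i hi
  rw [pair_comm] at h2
  have : ∃ G ∈ fiber 𝓕 {i, j} F,
      G ∉ {G ∈ fiber 𝓕 {i, j} F | G i ∈ W} ∪ {G ∈ fiber 𝓕 {i, j} F | G j ∈ W} := by
    apply exists_mem_notMem_of_card_lt_card
    have := h F hF
    have := card_union_le {G ∈ fiber 𝓕 {i, j} F | G i ∈ W} {G ∈ fiber 𝓕 {i, j} F | G j ∈ W}
    omega
  obtain ⟨G, hG, hGn⟩ := this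
  simp only [mem_union, mem_filter, hG, true_and, not_or] at hGn
  rw [mem_fiber] at hG
  refine ⟨G, hG.1, hG.2, fun l hl => ?_⟩
  rcases mem_insert.1 hl with rfl | hl
  · exact hGn.1
  · rw [mem_singleton.1 hl]; exact hGn.2

/-- Coordinates of members of `𝓕` determine their positions. -/
def Partite (𝓕 : Finset (ι → V)) : Prop :=
  ∀ F ∈ 𝓕, ∀ G ∈ 𝓕, ∀ i j, F i = G j → i = j

theorem Partite.mono {𝓕 𝓖 : Finset (ι → V)} (h : Partite 𝓖) (hs : 𝓕 ⊆ 𝓖) : Partite 𝓕 :=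
  fun F hF G hG => h F (hs hF) G (hs hG)

theorem Partite.disjoint_image {𝓕 : Finset (ι → V)} (h : Partite 𝓕) {F G : ι → V} (hF : F ∈ 𝓕)
    (hG : G ∈ 𝓕) {α β : Finset ι} (hd : Disjoint α β) : Disjoint (α.image F) (β.image G) := by
  rw [disjoint_left]
  intro v hv hv'
  obtain ⟨i, hi, rfl⟩ := mem_image.1 hv
  obtain ⟨j, hj, hij⟩ := mem_image.1 hv'
  exact disjoint_left.1 hd hi (h G hG F hF j i hij ▸ hj)

theorem movable_of_card_inter_ne_one {𝓕 : Finset (ι → V)} {D : ℕ} {N A : Finset ι}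
    (hN : ∀ i ∈ N, Rigid 𝓕 i) (h1 : ∀ i ∉ N, ∀ F ∈ 𝓕, D ≤ (fiber 𝓕 {i} F).card)
    (h2 : ∀ i j, i ≠ j → ∀ F ∈ 𝓕, 2 * D ≤ (fiber 𝓕 {i, j} F).card)
    (hA : (A ∩ N).card ≠ 1) : Movable 𝓕 D A := by
  have hm : Movable 𝓕 D (A \ N) := by
    have := Movable.biUnion (A \ N) (fun i => ({i} : Finset ι)) (𝓕 := 𝓕) (D := D)
      fun i hi => movable_singleton (h1 i (mem_sdiff.1 hi).2)
    simpa using this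
  have hn : Movable 𝓕 D (A ∩ N) := by
    have := Movable.biUnion (A ∩ N).offDiag (fun p => ({p.1, p.2} : Finset ι)) (𝓕 := 𝓕) (D := D)
      fun p hp => by
        rw [mem_offDiag] at hp
        exact movable_pair (hN _ (mem_inter.1 hp.1).2) (hN _ (mem_inter.1 hp.2.1).2)
          (h2 _ _ hp.2.2)
    convert this using 1
    ext i
    simp only [mem_biUnion, mem_offDiag, mem_insert, mem_singleton, Prod.exists]
    constructor
    · intro hi
      have : 1 < (A ∩ N).card := by
        have : 0 < (A ∩ N).card := card_pos.2 ⟨i, hi⟩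
        omega
      obtain ⟨j, hj, hji⟩ := exists_mem_ne this i
      exact ⟨i, j, ⟨hi, hj, hji.symm⟩, Or.inl rfl⟩
    · rintro ⟨a, b, ⟨ha, hb, -⟩, rfl | rfl⟩
      · exact ha
      · exact hb
  have := hm.union hn
  rwa [sdiff_union_inter] at this

theorem exists_homogeneous_or_card_le {n : ℕ} (D : ℕ) (𝓕 : Finset (ι → Fin n)) (N : Finset ι) :
    (∃ 𝓕' ⊆ 𝓕, 𝓕'.Nonempty ∧ (∀ i ∉ N, ∀ F ∈ 𝓕', D ≤ (fiber 𝓕' {i} F).card) ∧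
        ∀ i j, i ≠ j → ∀ F ∈ 𝓕', D ≤ (fiber 𝓕' {i, j} F).card) ∨
      ∃ R : ι → Finset (ι → Fin n), (∀ i, R i ⊆ 𝓕 ∧ Rigid (R i) i) ∧
        𝓕.card ≤ ∑ i ∈ Nᶜ, D * (R i).card +
          Fintype.card ι ^ 2 * (D * n ^ (Fintype.card ι - 2)) := by
  obtain ⟨𝓕', hsub, R, h1, h2, h3⟩ := exists_clean
    (Nᶜ.image (fun i => ({i} : Finset ι)) ∪ univ.offDiag.image fun p : ι × ι => {p.1, p.2}) D 𝓕
  rcases 𝓕'.eq_empty_or_nonempty with rfl | hne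
  · right
    have hT : ∀ i, ∃ R' ⊆ R {i}, Rigid R' i ∧ (R {i}).card ≤ D * R'.card := by
      intro i
      obtain ⟨R', hR', hr, hc⟩ := exists_transversal (h3 {i}).2
      exact ⟨R', hR', fun F hF G hG h => hr F hF G hG fun l hl => h l (by simpa using hl), hc⟩
    choose R' hR' hr hc using hT
    refine ⟨R', fun i => ⟨(hR' i).trans (h3 _).1, hr i⟩, ?_⟩
    rw [empty_union, union_biUnion, image_biUnion, image_biUnion] at h2
    refine (card_le_card h2).trans ((card_union_le _ _).trans (add_le_add ?_ ?_))
    · exact card_biUnion_le.trans (sum_le_sum fun i _ => hc i)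
    · refine (card_biUnion_le_card_mul _ _ (D * n ^ (Fintype.card ι - 2)) fun p hp => ?_).trans ?_
      · have h := card_le_of_card_fiber_le (B := univ) (fun _ _ _ => mem_univ _)
          (h3 {p.1, p.2}).2
        rwa [card_pair (mem_offDiag.1 hp).2.2, card_univ, Fintype.card_fin] at h
      · refine Nat.mul_le_mul_right _ ?_
        rw [offDiag_card, card_univ, sq]
        exact Nat.sub_le _ _
  · left
    refine ⟨𝓕', hsub, hne, fun i hi => h1 _ ?_, fun i j hij => h1 _ ?_⟩
    · exact mem_union_left _ (mem_image.2 ⟨i, by simpa using hi, rfl⟩)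
    · exact mem_union_right _ (mem_image.2 ⟨(i, j), by simpa using hij, rfl⟩)

theorem Rigid.mono {𝓕 𝓖 : Finset (ι → V)} {i : ι} (h : Rigid 𝓖 i) (hs : 𝓕 ⊆ 𝓖) : Rigid 𝓕 i :=
  fun F hF G hG => h F (hs hF) G (hs hG)

theorem exists_homogeneous (ι : Type*) [Fintype ι] [DecidableEq ι] (D m : ℕ) :
    ∃ C : ℕ, ∀ (n : ℕ) (𝓕 : Finset (ι → Fin n)) (N : Finset ι), Nᶜ.card ≤ m →
      (∀ i ∈ N, Rigid 𝓕 i) → C * n ^ (Fintype.card ι - 2) < 𝓕.card →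
      ∃ 𝓕' ⊆ 𝓕, ∃ N' : Finset ι, 𝓕'.Nonempty ∧ (∀ i ∈ N', Rigid 𝓕' i) ∧
        (∀ i ∉ N', ∀ F ∈ 𝓕', D ≤ (fiber 𝓕' {i} F).card) ∧
        ∀ i j, i ≠ j → ∀ F ∈ 𝓕', D ≤ (fiber 𝓕' {i, j} F).card := by
  induction m with
  | zero =>
    refine ⟨Fintype.card ι ^ 2 * D, fun n 𝓕 N hN hr hc => ?_⟩
    rcases exists_homogeneous_or_card_le D 𝓕 N with ⟨𝓕', hs, hne, h1, h2⟩ | ⟨R, -, hR⟩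
    · exact ⟨𝓕', hs, N, hne, fun i hi => (hr i hi).mono hs, h1, h2⟩
    · rw [card_eq_zero.1 (Nat.le_zero.1 hN), sum_empty, zero_add, ← mul_assoc] at hR
      exact absurd hc (not_lt.2 hR)
  | succ m ih =>
    obtain ⟨C, hC⟩ := ih
    refine ⟨Fintype.card ι * (D * C) + Fintype.card ι ^ 2 * D, fun n 𝓕 N hN hr hc => ?_⟩
    rcases exists_homogeneous_or_card_le D 𝓕 N with ⟨𝓕', hs, hne, h1, h2⟩ | ⟨R, hR, hR'⟩
    · exact ⟨𝓕', hs, N, hne, fun i hi => (hr i hi).mono hs, h1, h2⟩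
    · by_cases hbig : ∃ i ∉ N, C * n ^ (Fintype.card ι - 2) < (R i).card
      · obtain ⟨i, hi, hlt⟩ := hbig
        obtain ⟨𝓕', hs, N', h⟩ := hC n (R i) (insert i N) (by
          rw [compl_insert, card_erase_of_mem (by simpa using hi)]; omega) (fun j hj => by
          rcases mem_insert.1 hj with rfl | hj
          · exact (hR _).2
          · exact (hr j hj).mono (hR _).1) hlt
        exact ⟨𝓕', hs.trans (hR i).1, N', h⟩
      · push Not at hbig
        refine absurd hc (not_lt.2 (hR'.trans ?_))
        rw [add_mul, mul_assoc _ D, mul_assoc, mul_assoc D]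
        refine Nat.add_le_add_right ?_ _
        refine (sum_le_card_nsmul Nᶜ _ (D * (C * n ^ (Fintype.card ι - 2))) fun i hi =>
          Nat.mul_le_mul_left _ (hbig i (by simpa using hi))).trans ?_
        rw [smul_eq_mul]
        exact Nat.mul_le_mul_right _ (card_le_univ _)

end tuples

theorem exists_coloring {α V C : Type*} [Fintype V] [DecidableEq V] [Fintype C] [DecidableEq C]
    [Nonempty C] (𝒮 : Finset α) (S : α → Finset V) (col : α → V → C) (d : ℕ)
    (hd : ∀ a ∈ 𝒮, (S a).card ≤ d) :
    ∃ χ : V → C, 𝒮.card ≤ Fintype.card C ^ d * {a ∈ 𝒮 | ∀ v ∈ S a, χ v = col a v}.card := by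
  have hcount : ∀ a ∈ 𝒮, Fintype.card C ^ Fintype.card V ≤
      Fintype.card C ^ d * ({χ : V → C | ∀ v ∈ S a, χ v = col a v} : Finset (V → C)).card := by
    intro a ha
    have : ({χ : V → C | ∀ v ∈ S a, χ v = col a v} : Finset (V → C)) =
        Fintype.piFinset fun v => if v ∈ S a then {col a v} else univ := by
      ext χ
      simp only [mem_filter, mem_univ, true_and, Fintype.mem_piFinset]
      refine forall_congr' fun v => ?_
      split_ifs with h <;> simp [h]
    rw [this, Fintype.card_piFinset]
    have h2 : ∀ v, (if v ∈ S a then ({col a v} : Finset C) else univ).card =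
        if v ∈ S a then 1 else Fintype.card C := by
      intro v; split_ifs <;> simp
    simp only [h2]
    rw [prod_ite, prod_const_one, one_mul, prod_const, ← pow_add]
    refine Nat.pow_le_pow_right Fintype.card_pos ?_
    have h3 := card_filter_add_card_filter_not (s := (univ : Finset V)) (fun v => v ∈ S a)
    rw [filter_mem_eq_inter, univ_inter, card_univ] at h3
    have := hd a ha
    omega
  have hsum : ∑ _χ : V → C, 𝒮.card ≤ ∑ χ : V → C,
      Fintype.card C ^ d * {a ∈ 𝒮 | ∀ v ∈ S a, χ v = col a v}.card := by
    rw [← mul_sum]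
    have hdc : ∑ χ : V → C, {a ∈ 𝒮 | ∀ v ∈ S a, χ v = col a v}.card =
        ∑ a ∈ 𝒮, ({χ : V → C | ∀ v ∈ S a, χ v = col a v} : Finset (V → C)).card := by
      simp only [card_filter]
      exact sum_comm
    rw [hdc, mul_sum, sum_const, card_univ, Fintype.card_fun, smul_eq_mul, mul_comm,
      ← smul_eq_mul, ← sum_const]
    exact sum_le_sum hcount
  obtain ⟨χ, -, hχ⟩ := exists_le_of_sum_le univ_nonempty hsum
  exact ⟨χ, hχ⟩

theorem Partite.injective {ι V : Type*} {𝓕 : Finset (ι → V)} (h : Partite 𝓕) {F : ι → V}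
    (hF : F ∈ 𝓕) : Function.Injective F :=
  fun i j hij => h F hF F hF i j hij

/-- An `m`-uniform hypergraph contains a positive proportion of edges which can be enumerated
consistently by `Fin m`, and such that moreover each edge `e` avoids the sets `T e'`
attached to the others. -/
theorem exists_partite {m d : ℕ} (hm : 0 < m) {V : Type*} [Fintype V] [DecidableEq V]
    {H : Finset (Finset V)} (hH : ∀ e ∈ H, e.card = m) (T : Finset V → Finset V)
    (hT : ∀ e ∈ H, (T e).card ≤ d ∧ Disjoint e (T e)) :
    ∃ 𝓕 : Finset (Fin m → V), Partite 𝓕 ∧ (∀ F ∈ 𝓕, univ.image F ∈ H) ∧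
      (∀ F ∈ 𝓕, ∀ G ∈ 𝓕, ∀ i, F i ∉ T (univ.image G)) ∧
      H.card ≤ (m + 1) ^ (m + d) * 𝓕.card := by
  rcases H.eq_empty_or_nonempty with rfl | ⟨e₀, he₀⟩
  · exact ⟨∅, by simp [Partite]⟩
  have hen : ∀ e ∈ H, ∃ f : Fin m → V, Function.Injective f ∧ univ.image f = e := by
    intro e he
    refine ⟨fun i => ((e.equivFinOfCardEq (hH e he)).symm i : V), ?_, ?_⟩
    · exact Subtype.val_injective.comp (Equiv.injective _)
    · ext v
      simp only [mem_image, mem_univ, true_and]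
      constructor
      · rintro ⟨i, rfl⟩; exact coe_mem _
      · intro hv; exact ⟨e.equivFinOfCardEq (hH e he) ⟨v, hv⟩, by simp⟩
  obtain ⟨v₀, -⟩ := card_pos.1 (hm.trans_eq (hH e₀ he₀).symm)
  have : Nonempty (Fin m → V) := ⟨fun _ => v₀⟩
  have : Nonempty (Fin m) := ⟨⟨0, hm⟩⟩
  choose! en hinj him using hen
  obtain ⟨χ, hχ⟩ := exists_coloring (C := Option (Fin m)) H (fun e => e ∪ T e)
    (fun e v => if v ∈ e then some (Function.invFun (en e) v) else none) (m + d) (fun e he =>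
      (card_union_le _ _).trans (add_le_add (hH e he).le (hT e he).1))
  have hmem : ∀ e ∈ H, ∀ i, en e i ∈ e := fun e he i =>
    (him e he).subset (mem_image_of_mem _ (mem_univ i))
  have hcol : ∀ e ∈ H, (∀ v ∈ e ∪ T e, χ v = if v ∈ e then some (Function.invFun (en e) v)
      else none) → ∀ i, χ (en e i) = some i := by
    intro e he h i
    rw [h _ (mem_union_left _ (hmem e he i)), if_pos (hmem e he i),
      Function.leftInverse_invFun (hinj e he) i]
  refine ⟨{e ∈ H | ∀ v ∈ e ∪ T e, χ v = if v ∈ e then some (Function.invFun (en e) v)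
      else none}.image en, ?_, ?_, ?_, ?_⟩
  · intro F hF G hG i j hij
    obtain ⟨e, he, rfl⟩ := mem_image.1 hF
    obtain ⟨e', he', rfl⟩ := mem_image.1 hG
    rw [mem_filter] at he he'
    have h1 := hcol e he.1 he.2 i
    rw [hij, hcol e' he'.1 he'.2 j] at h1
    exact (Option.some_injective _ h1).symm
  · intro F hF
    obtain ⟨e, he, rfl⟩ := mem_image.1 hF
    rw [mem_filter] at he
    rw [him e he.1]
    exact he.1
  · intro F hF G hG i hi
    obtain ⟨e, he, rfl⟩ := mem_image.1 hF
    obtain ⟨e', he', rfl⟩ := mem_image.1 hG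
    rw [mem_filter] at he he'
    rw [him e' he'.1] at hi
    have h1 := hcol e he.1 he.2 i
    rw [he'.2 _ (mem_union_right _ hi),
      if_neg (disjoint_right.1 (hT e' he'.1).2 hi)] at h1
    exact absurd h1 (by simp)
  · rw [card_image_of_injOn]
    · simpa using hχ
    · intro e he e' he' h
      rw [mem_coe, mem_filter] at he he'
      rw [← him e he.1, ← him e' he'.1, h]

theorem isKernel_of_movable {ι V : Type*} [Fintype ι] [DecidableEq ι] [DecidableEq V]
    {H : Finset (Finset V)} {𝓕 : Finset (ι → V)} {K D : ℕ} (hi : ∀ F ∈ 𝓕, univ.image F ∈ H)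
    (hK : K < D) {γ : Finset ι} (hγ : Movable 𝓕 D γᶜ) {F : ι → V} (hF : F ∈ 𝓕) :
    IsKernel H K (γ.image F) := by
  intro W hW hd
  obtain ⟨F', hF', h1, h2⟩ := hγ F hF W (hW.trans_lt hK)
  have h3 : ∀ i ∈ γ, F' i = F i := fun i hi => h1 i (by simpa using hi)
  refine ⟨univ.image F', hi _ hF', fun v hv => ?_, disjoint_left.2 fun v hv => ?_⟩
  · obtain ⟨i, hi, rfl⟩ := mem_image.1 hv
    exact mem_image.2 ⟨i, mem_univ _, h3 i hi⟩
  · obtain ⟨i, -, rfl⟩ := mem_image.1 hv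
    by_cases hiγ : i ∈ γ
    · rw [h3 i hiγ]
      exact disjoint_right.1 hd (mem_image_of_mem _ hiγ)
    · exact h2 i (by simpa using hiγ)

theorem card_biUnion_range_le {V : Type*} [DecidableEq V] {s c : ℕ} {X : ℕ → Finset V}
    (h : ∀ i < s, (X i).card ≤ c) : ((range s).biUnion X).card ≤ s * c := by
  have := card_biUnion_le_card_mul (range s) X c fun i hi => h i (mem_range.1 hi)
  rwa [card_range] at this

theorem not_cycleFree_of_zigzag {k t n D : ℕ} (ht : 2 ≤ t) {H : Finset (Finset (Fin n))}
    (hH : ∀ e ∈ H, e.card = k) {ι : Type*} [Fintype ι] [DecidableEq ι]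
    {𝓕 : Finset (ι → Fin n)} (hp : Partite 𝓕) (hne : 𝓕.Nonempty)
    (him : ∀ F ∈ 𝓕, univ.image F ∈ H) {α β μ U : Finset ι} (hα : α.Nonempty) (hβ : β.Nonempty)
    (hμ : μ.Nonempty) (hαβ : Disjoint α β) (hαμ : Disjoint α μ) (hβμ : Disjoint β μ)
    (hμU : μ ⊆ U) (hUα : Disjoint U α) (hUβ : Disjoint U β) (hU : Movable 𝓕 D U)
    (hA : Movable 𝓕 D (α ∪ μ)ᶜ) (hB : Movable 𝓕 D (β ∪ μ)ᶜ) (hD : 2 * (2 * t + 1) * k < D) :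
    ¬ CycleFree k t H := by
  have hcard : ∀ F ∈ 𝓕, ∀ γ : Finset ι, (γ.image F).card ≤ k := fun F hF γ =>
    (card_le_card (image_subset_image (subset_univ γ))).trans (hH _ (him F hF)).le
  have key : ∀ s, s < t → ∃ X Y : ℕ → Finset (Fin n), ∃ F ∈ 𝓕, Y 0 = α.image F ∧
      Y (s + 1) = β.image F ∧ (∀ i ≤ s, ∃ G ∈ 𝓕, X i = μ.image G) ∧
      (∀ i, 0 < i → i ≤ s + 1 → ∃ G ∈ 𝓕, Y i = β.image G) ∧
      (∀ i ≤ s, ∀ j < i, Disjoint (X i) (X j)) ∧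
      (∀ i ≤ s + 1, ∀ j < i, Disjoint (Y i) (Y j)) ∧
      ∀ i ≤ s, IsKernel H (2 * (2 * t + 1) * k) (Y i ∪ X i) ∧
        IsKernel H (2 * (2 * t + 1) * k) (X i ∪ Y (i + 1)) := by
    intro s
    induction s with
    | zero =>
      intro _
      obtain ⟨F, hF⟩ := hne
      refine ⟨fun _ => μ.image F, fun i => if i = 0 then α.image F else β.image F, F, hF, by simp,
        by simp, fun i _ => ⟨F, hF, rfl⟩, fun i hi _ => ⟨F, hF, by simp [hi.ne']⟩, by omega, ?_, ?_⟩
      · intro i hi j hj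
        obtain rfl : i = 1 := by omega
        obtain rfl : j = 0 := by omega
        simpa using (hp.disjoint_image hF hF hαβ).symm
      · intro i hi
        obtain rfl : i = 0 := by omega
        simp only [if_true, ← image_union, zero_add, one_ne_zero, if_false]
        refine ⟨isKernel_of_movable him hD hA hF, ?_⟩
        rw [union_comm]
        exact isKernel_of_movable him hD hB hF
    | succ s ih =>
      intro hs
      obtain ⟨X, Y, F, hF, hY0, hYs, hX, hY, hXX, hYY, hker⟩ := ih (by omega)
      have hsk : (s + 2) * k ≤ 2 * (2 * t + 1) * k := Nat.mul_le_mul_right _ (by omega)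
      have hsk' : (s + 1) * k ≤ 2 * (2 * t + 1) * k := Nat.mul_le_mul_right _ (by omega)
      obtain ⟨F₁, hF₁, h1, h1'⟩ := hU F hF ((range (s + 1)).biUnion X) (by
        refine (card_biUnion_range_le (c := k) fun i hi => ?_).trans_lt (hsk'.trans_lt hD)
        obtain ⟨G, hG, h⟩ := hX i (by omega)
        rw [h]; exact hcard G hG _)
      obtain ⟨F₂, hF₂, h2, h2'⟩ := hA F₁ hF₁ ((range (s + 2)).biUnion Y) (by
        refine (card_biUnion_range_le (c := k) fun i hi => ?_).trans_lt (hsk.trans_lt hD)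
        rcases Nat.eq_zero_or_pos i with rfl | hi0
        · rw [hY0]; exact hcard F hF _
        · obtain ⟨G, hG, h⟩ := hY i hi0 (by omega)
          rw [h]; exact hcard G hG _)
      have h1α : ∀ i ∈ α, F₁ i = F i := fun i hi => h1 i (disjoint_right.1 hUα hi)
      have h1β : ∀ i ∈ β, F₁ i = F i := fun i hi => h1 i (disjoint_right.1 hUβ hi)
      have h2α : ∀ i ∈ α, F₂ i = F₁ i := fun i hi => h2 i (by simp [hi])
      have h2μ : ∀ i ∈ μ, F₂ i = F₁ i := fun i hi => h2 i (by simp [hi])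
      have h2β : ∀ i ∈ β, F₂ i ∉ (range (s + 2)).biUnion Y := fun i hi => h2' i (by
        simp [disjoint_right.1 hαβ hi, disjoint_left.1 hβμ hi])
      refine ⟨Function.update X (s + 1) (μ.image F₁), Function.update Y (s + 2) (β.image F₂),
        F₂, hF₂, ?_, ?_, ?_, ?_, ?_, ?_, ?_⟩
      · rw [Function.update_of_ne (by omega), hY0]
        exact image_congr fun i hi => by rw [h2α i hi, h1α i hi]
      · rw [Function.update_self]
      · intro i hi
        rcases hi.lt_or_eq with h | rfl
        · rw [Function.update_of_ne (by omega)]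
          exact hX i (by omega)
        · exact ⟨F₁, hF₁, Function.update_self ..⟩
      · intro i hi0 hi
        rcases hi.lt_or_eq with h | rfl
        · rw [Function.update_of_ne (by omega)]
          exact hY i hi0 (by omega)
        · exact ⟨F₂, hF₂, Function.update_self ..⟩
      · intro i hi j hj
        rw [Function.update_of_ne (by omega : j ≠ s + 1)]
        rcases hi.lt_or_eq with h | rfl
        · rw [Function.update_of_ne (by omega)]
          exact hXX i (by omega) j hj
        · rw [Function.update_self, disjoint_left]
          intro v hv hvj
          obtain ⟨l, hl, rfl⟩ := mem_image.1 hv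
          exact h1' l (hμU hl) (mem_biUnion.2 ⟨j, mem_range.2 hj, hvj⟩)
      · intro i hi j hj
        rw [Function.update_of_ne (by omega : j ≠ s + 2)]
        rcases hi.lt_or_eq with h | rfl
        · rw [Function.update_of_ne (by omega)]
          exact hYY i (by omega) j hj
        · rw [Function.update_self, disjoint_left]
          intro v hv hvj
          obtain ⟨l, hl, rfl⟩ := mem_image.1 hv
          exact h2β l hl (mem_biUnion.2 ⟨j, mem_range.2 hj, hvj⟩)
      · intro i hi
        rw [Function.update_of_ne (by omega : i ≠ s + 2)]
        rcases hi.lt_or_eq with h | rfl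
        · rw [Function.update_of_ne (by omega), Function.update_of_ne (by omega)]
          exact hker i (by omega)
        · rw [Function.update_self, Function.update_self, hYs]
          constructor
          · rw [← image_congr (s := β) (f := F₁) fun i hi => h1β i hi, ← image_union]
            exact isKernel_of_movable him hD hB hF₁
          · rw [← image_congr (s := μ) (f := F₂) fun i hi => h2μ i hi, ← image_union, union_comm]
            exact isKernel_of_movable him hD hB hF₂
  obtain ⟨s, rfl⟩ : ∃ s, t = s + 1 := ⟨t - 1, by omega⟩
  obtain ⟨X, Y, F, hF, hY0, hYs, hX, hY, hXX, hYY, hker⟩ := key s (by omega)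
  obtain ⟨F', hF', h1, h2⟩ := hU F hF ((range (s + 1)).biUnion X) (by
    refine (card_biUnion_range_le (c := k) fun i hi => ?_).trans_lt (lt_of_le_of_lt
      (Nat.mul_le_mul_right _ (by omega)) hD)
    obtain ⟨G, hG, h⟩ := hX i (by omega)
    rw [h]; exact hcard G hG _)
  have h1α : α.image F' = α.image F := image_congr fun i hi => h1 i (disjoint_right.1 hUα hi)
  have h1β : β.image F' = β.image F := image_congr fun i hi => h1 i (disjoint_right.1 hUβ hi)
  have hXne : ∀ i < s + 1, (X i).Nonempty := fun i hi => by
    obtain ⟨G, hG, h⟩ := hX i (by omega)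
    rw [h]; exact hμ.image _
  have hYne : ∀ i ≤ s + 1, (Y i).Nonempty := fun i hi => by
    rcases Nat.eq_zero_or_pos i with rfl | hi0
    · rw [hY0]; exact hα.image _
    · obtain ⟨G, hG, h⟩ := hY i hi0 (by omega)
      rw [h]; exact hβ.image _
  refine not_cycleFree_of_path ht hH le_rfl X Y (fun i hi => hXX i (by omega)) hYY ?_ hXne hYne
    (fun i hi => hker i (by omega)) (him F' hF') ?_ ?_ ?_ ?_
  · intro i hi j hj
    obtain ⟨G, hG, h⟩ := hX i (by omega)
    rw [h]
    rcases Nat.eq_zero_or_pos j with rfl | hj0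
    · rw [hY0]; exact hp.disjoint_image hG hF hαμ.symm
    · obtain ⟨G', hG', h'⟩ := hY j hj0 (by omega)
      rw [h']; exact hp.disjoint_image hG hG' hβμ.symm
  · rw [hY0, ← h1α]; exact image_subset_image (subset_univ _)
  · rw [hYs, ← h1β]; exact image_subset_image (subset_univ _)
  · intro i hi
    rw [disjoint_left]
    intro v hv hvX
    obtain ⟨j, -, rfl⟩ := mem_image.1 hv
    obtain ⟨G, hG, h⟩ := hX i (by omega)
    have hvX' := hvX
    rw [h] at hvX'
    obtain ⟨l, hl, hlj⟩ := mem_image.1 hvX'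
    have := hp G hG F' hF' l j hlj
    subst this
    exact h2 l (hμU hl) (mem_biUnion.2 ⟨i, mem_range.2 hi, hvX⟩)
  · intro i hi hi0
    rw [disjoint_left]
    intro v hv hvY
    obtain ⟨j, -, rfl⟩ := mem_image.1 hv
    obtain ⟨G, hG, h⟩ := hY i hi0 (by omega)
    have hvY' := hvY
    rw [h] at hvY'
    obtain ⟨l, hl, hlj⟩ := mem_image.1 hvY'
    have := hp G hG F' hF' l j hlj
    subst this
    refine disjoint_left.1 (hYY (s + 1) le_rfl i hi) ?_ hvY
    rw [hYs, ← h1β]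
    exact mem_image_of_mem _ hl

theorem card_le_one_of_homogeneous {k t n D : ℕ} (hk : 4 ≤ k) (ht : 2 ≤ t)
    {H : Finset (Finset (Fin n))} (hH : ∀ e ∈ H, e.card = k) (hfree : CycleFree k t H)
    {𝓕 : Finset (Fin k → Fin n)} (hp : Partite 𝓕) (hne : 𝓕.Nonempty)
    (him : ∀ F ∈ 𝓕, univ.image F ∈ H) {N : Finset (Fin k)} (hN : ∀ i ∈ N, Rigid 𝓕 i)
    (h1 : ∀ i ∉ N, ∀ F ∈ 𝓕, D ≤ (fiber 𝓕 {i} F).card)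
    (h2 : ∀ i j, i ≠ j → ∀ F ∈ 𝓕, 2 * D ≤ (fiber 𝓕 {i, j} F).card)
    (hD : 2 * (2 * t + 1) * k < D) : N.card ≤ 1 := by
  by_contra! hcard
  have hmv : ∀ A : Finset (Fin k), (A ∩ N).card ≠ 1 → Movable 𝓕 D A := fun A hA =>
    movable_of_card_inter_ne_one hN h1 h2 hA
  have hcc : N.card + Nᶜ.card = k := by rw [card_add_card_compl, Fintype.card_fin]
  have herase : ∀ A : Finset (Fin k), Aᶜ ∩ N = N \ A := fun A => by
    ext; simp [and_comm]
  rcases Nᶜ.eq_empty_or_nonempty with he | ⟨m, hm⟩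
  · have hNu : N = univ := by simpa using he
    subst hNu
    have hpair : ∀ a b : Fin k, a ≠ b → ((({a} ∪ {b} : Finset (Fin k)))ᶜ ∩ univ).card ≠ 1 := by
      intro a b hab
      rw [inter_univ, card_compl, Fintype.card_fin, ← insert_eq, card_pair hab]
      omega
    have h01 : (⟨0, by omega⟩ : Fin k) ≠ ⟨1, by omega⟩ := by simp
    have h02 : (⟨0, by omega⟩ : Fin k) ≠ ⟨2, by omega⟩ := by simp
    have h12 : (⟨1, by omega⟩ : Fin k) ≠ ⟨2, by omega⟩ := by simp
    refine not_cycleFree_of_zigzag ht hH hp hne him (α := {⟨0, by omega⟩}) (β := {⟨1, by omega⟩})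
      (μ := {⟨2, by omega⟩}) (U := ({⟨0, by omega⟩} ∪ {⟨1, by omega⟩})ᶜ) (singleton_nonempty _)
      (singleton_nonempty _) (singleton_nonempty _) ?_ ?_ ?_ ?_ ?_ ?_ (hmv _ (hpair _ _ h01))
      (hmv _ (hpair _ _ h02)) (hmv _ (hpair _ _ h12)) hD hfree
    all_goals simp
  have hmN : m ∉ N := by simpa using hm
  rcases Nat.lt_or_ge 2 N.card with h3 | h3
  · obtain ⟨a, ha, b, hb, hab⟩ := one_lt_card.1 hcard
    have ham : a ≠ m := fun h => hmN (h ▸ ha)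
    have hbm : b ≠ m := fun h => hmN (h ▸ hb)
    have hpair : ∀ a ∈ N, (({a} ∪ {m} : Finset (Fin k))ᶜ ∩ N).card ≠ 1 := by
      intro a ha
      have : N \ ({a} ∪ {m}) = N.erase a := by
        ext i; simp only [mem_sdiff, mem_union, mem_singleton, mem_erase]
        constructor
        · tauto
        · rintro ⟨h, h'⟩; exact ⟨h', by rintro (h'' | rfl) <;> tauto⟩
      rw [herase, this, card_erase_of_mem ha]
      omega
    refine not_cycleFree_of_zigzag ht hH hp hne him (α := {a}) (β := {b})
      (μ := {m}) (U := {m}) (singleton_nonempty _) (singleton_nonempty _) (singleton_nonempty _)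
      ?_ ?_ ?_ ?_ ?_ ?_ (hmv _ ?_) (hmv _ (hpair _ ha)) (hmv _ (hpair _ hb)) hD hfree
    · simpa
    · simpa
    · simpa
    · simp
    · simpa using ham.symm
    · simpa using hbm.symm
    · simp [hmN]
  · obtain ⟨c, hc, d, hd, hcd⟩ := one_lt_card.1 (show 1 < Nᶜ.card by omega)
    rw [mem_compl] at hc hd
    refine not_cycleFree_of_zigzag ht hH hp hne him (α := N) (β := {c})
      (μ := {d}) (U := {d}) (card_pos.1 (by omega)) (singleton_nonempty _) (singleton_nonempty _)
      ?_ ?_ ?_ ?_ ?_ ?_ (hmv _ ?_) (hmv _ ?_) (hmv _ ?_) hD hfree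
    · simpa
    · simpa
    · simpa
    · simp
    · simpa
    · simpa using hcd.symm
    · simp [hd]
    · rw [herase, sdiff_eq_empty_iff_subset.2 subset_union_left]; simp
    · rw [herase, sdiff_eq_self_of_disjoint]
      · omega
      · rw [← insert_eq, disjoint_insert_right, disjoint_singleton_right]; exact ⟨hc, hd⟩

/-- `f` belongs to a family of sets which all form edges of `H` together with `x`, and in which
every vertex of every member can be replaced in at least `D` ways. -/
def InCore {V : Type*} [Fintype V] [DecidableEq V] (H : Finset (Finset V)) (D : ℕ) (x : V)
    (f : Finset V) : Prop :=
  ∃ Q : Finset (Finset V), f ∈ Q ∧ (∀ g ∈ Q, x ∉ g ∧ insert x g ∈ H) ∧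
    ∀ g ∈ Q, ∀ y ∈ g, D ≤ ({z | insert z (g.erase y) ∈ Q} : Finset V).card

section core
variable {V : Type*} [Fintype V] [DecidableEq V] {H : Finset (Finset V)} {D K : ℕ} {x y : V}
  {f : Finset V}

theorem InCore.notMem (h : InCore H D x f) : x ∉ f := by
  obtain ⟨Q, hf, h1, -⟩ := h
  exact (h1 f hf).1

theorem InCore.insert_mem (h : InCore H D x f) : insert x f ∈ H := by
  obtain ⟨Q, hf, h1, -⟩ := h
  exact (h1 f hf).2

theorem InCore.exists_disjoint (h : InCore H D x f) (hK : K < D) (W A : Finset V)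
    (hW : W.card ≤ K) (hA : A ⊆ f) (hWA : Disjoint W A) :
    ∃ g, A ⊆ g ∧ Disjoint g W ∧ InCore H D x g := by
  obtain ⟨Q, hf, h1, h2⟩ := h
  obtain ⟨g, hg, hmin⟩ := exists_min_image {g ∈ Q | A ⊆ g} (fun g => (g ∩ W).card)
    ⟨f, mem_filter.2 ⟨hf, hA⟩⟩
  rw [mem_filter] at hg
  refine ⟨g, hg.2, ?_, Q, hg.1, h1, h2⟩
  rw [disjoint_iff_inter_eq_empty]
  by_contra hne
  obtain ⟨z, hz⟩ := nonempty_iff_ne_empty.2 hne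
  have hzg := mem_inter.1 hz
  obtain ⟨y', hy', hyW⟩ := exists_mem_notMem_of_card_lt_card
    (hW.trans_lt (hK.trans_le (h2 g hg.1 z hzg.1)))
  rw [mem_filter] at hy'
  have := hmin (insert y' (g.erase z)) (mem_filter.2 ⟨hy'.2, fun a ha => mem_insert_of_mem
    (mem_erase.2 ⟨fun h => disjoint_left.1 hWA hzg.2 (h ▸ ha), hg.2 ha⟩)⟩)
  rw [insert_inter_of_notMem hyW, erase_inter] at this
  exact absurd this (not_le.2 (card_erase_lt_of_mem hz))

theorem InCore.isKernel (h : InCore H D x f) (hK : K < D) (hy : y ∈ f) :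
    IsKernel H K {x, y} := by
  intro W hW hd
  rw [disjoint_insert_right, disjoint_singleton_right] at hd
  obtain ⟨g, hyg, hgW, hg⟩ := h.exists_disjoint hK W {y} hW (by simpa) (by simpa using hd.2)
  refine ⟨insert x g, hg.insert_mem, ?_, ?_⟩
  · exact insert_subset_insert _ hyg
  · rw [disjoint_insert_left]
    exact ⟨hd.1, hgW⟩

theorem InCore.le_card (h : InCore H D x f) (hy : y ∈ f) :
    D ≤ ({z | InCore H D x (insert z (f.erase y))} : Set V).ncard := by
  obtain ⟨Q, hf, h1, h2⟩ := h
  refine (h2 f hf y hy).trans ?_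
  rw [← Set.ncard_coe_finset]
  refine Set.ncard_le_ncard (fun z hz => ?_) (Set.toFinite _)
  rw [mem_coe, mem_filter] at hz
  exact ⟨Q, hz.2, h1, h2⟩

end core

theorem inCore_of_fibers {k n D : ℕ} {H : Finset (Finset (Fin n))} {𝓕 : Finset (Fin k → Fin n)}
    (hp : Partite 𝓕) (him : ∀ F ∈ 𝓕, univ.image F ∈ H) {p : Fin k}
    (h1 : ∀ i ≠ p, ∀ F ∈ 𝓕, D ≤ (fiber 𝓕 {i} F).card) {F₀ : Fin k → Fin n} (hF₀ : F₀ ∈ 𝓕) :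
    InCore H D (F₀ p) ((univ.image F₀).erase (F₀ p)) := by
  refine ⟨{F ∈ 𝓕 | F p = F₀ p}.image fun F => (univ.image F).erase (F₀ p), ?_, ?_, ?_⟩
  · exact mem_image.2 ⟨F₀, by simp [hF₀], rfl⟩
  · intro g hg
    obtain ⟨F, hF, rfl⟩ := mem_image.1 hg
    rw [mem_filter] at hF
    refine ⟨notMem_erase _ _, ?_⟩
    rw [insert_erase]
    · exact him F hF.1
    · rw [← hF.2]; exact mem_image_of_mem _ (mem_univ _)
  · intro g hg y hy
    obtain ⟨F, hF, rfl⟩ := mem_image.1 hg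
    rw [mem_filter] at hF
    rw [mem_erase] at hy
    obtain ⟨hyp, hy⟩ := hy
    obtain ⟨i, -, rfl⟩ := mem_image.1 hy
    have hip : i ≠ p := by rintro rfl; exact hyp hF.2
    refine (h1 i hip F hF.1).trans (card_le_card_of_injOn (fun G => G i) ?_ ?_)
    · intro G hG
      rw [mem_coe, mem_fiber] at hG
      rw [mem_coe, mem_filter]
      refine ⟨mem_univ _, mem_image.2 ⟨G, ?_, ?_⟩⟩
      · rw [mem_filter]
        exact ⟨hG.1, by rw [hG.2 p (by simpa using hip.symm), hF.2]⟩
      · have hGl : ∀ l, l ≠ i → G l = F l := fun l hl => hG.2 l (by simpa using hl)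
        ext w
        simp only [mem_erase, mem_image, mem_univ, true_and, mem_insert]
        constructor
        · rintro ⟨hw, l, rfl⟩
          by_cases hl : l = i
          · exact Or.inl (by rw [hl])
          · refine Or.inr ⟨?_, hw, l, (hGl l hl).symm⟩
            rw [hGl l hl]
            exact fun h => hl (hp.injective hF.1 h)
        · rintro (rfl | ⟨hw1, hw2, l, rfl⟩)
          · refine ⟨?_, i, rfl⟩
            rw [← hF.2]
            exact fun h => hip (hp G hG.1 F hF.1 i p h)
          · exact ⟨hw2, l, hGl l fun h => hw1 (by rw [h])⟩
    · intro G hG G' hG' he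
      rw [mem_coe, mem_fiber] at hG hG'
      funext l
      by_cases hl : l = i
      · subst hl; exact he
      · rw [hG.2 l (by simpa using hl), hG'.2 l (by simpa using hl)]

open Classical in
theorem card_coreless_le {k t D : ℕ} (hk : 4 ≤ k) (ht : 2 ≤ t)
    (hD : 2 * (2 * t + 1) * k < D) :
    ∃ C : ℕ, ∀ (n : ℕ) (H : Finset (Finset (Fin n))), (∀ e ∈ H, e.card = k) → CycleFree k t H →
      ({e ∈ H | ∀ x ∈ e, ¬ InCore H D x (e.erase x)}).card ≤ C * n ^ (k - 2) := by
  obtain ⟨C, hC⟩ := exists_homogeneous (Fin k) (2 * D) k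
  refine ⟨(k + 1) ^ (k + 0) * C, fun n H hH hfree => ?_⟩
  by_contra! hlt
  obtain ⟨𝓕, hp, him, -, hcard⟩ := exists_partite (d := 0) (by omega : 0 < k)
    (H := {e ∈ H | ∀ x ∈ e, ¬ InCore H D x (e.erase x)})
    (fun e he => hH e (mem_filter.1 he).1) (fun _ => ∅) (by simp)
  have hlt' := hlt.trans_le hcard
  rw [mul_assoc] at hlt'
  obtain ⟨𝓕', hs, N, hne, hN, h1, h2⟩ := hC n 𝓕 ∅ (by simp) (by simp)
    (by rw [Fintype.card_fin]; exact Nat.lt_of_mul_lt_mul_left hlt')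
  have him' : ∀ F ∈ 𝓕', univ.image F ∈ H := fun F hF => (mem_filter.1 (him F (hs hF))).1
  have h1' : ∀ i ∉ N, ∀ F ∈ 𝓕', D ≤ (fiber 𝓕' {i} F).card := fun i hi F hF =>
    le_trans (by omega) (h1 i hi F hF)
  have hN1 := card_le_one_of_homogeneous hk ht hH hfree (hp.mono hs) hne him' hN h1' h2 hD
  obtain ⟨p, hpN⟩ : ∃ p, ∀ i ∈ N, i = p := by
    rcases N.eq_empty_or_nonempty with rfl | ⟨p, hp⟩
    · exact ⟨⟨0, by omega⟩, by simp⟩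
    · exact ⟨p, fun i hi => card_le_one.1 hN1 i hi p hp⟩
  obtain ⟨F₀, hF₀⟩ := hne
  exact (mem_filter.1 (him F₀ (hs hF₀))).2 (F₀ p) (mem_image_of_mem _ (mem_univ _))
    (inCore_of_fibers (hp.mono hs) him' (fun i hi => h1' i fun h => hi (hpN i h)) hF₀)

theorem exists_seq {σ α : Type*} [DecidableEq α] (good : ℕ → σ → Prop) (step : ℕ → σ → σ → Prop)
    (v : ℕ → σ → α) (m : ℕ) (h0 : ∃ s, good 0 s)
    (hstep : ∀ i < m, ∀ s, good i s → ∀ W : Finset α, W.card ≤ m →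
      ∃ s', good (i + 1) s' ∧ step i s s' ∧ v (i + 1) s' ∉ W) :
    ∃ u : ℕ → σ, (∀ i ≤ m, good i (u i)) ∧ (∀ i < m, step i (u i) (u (i + 1))) ∧
      ∀ i ≤ m, ∀ j < i, v i (u i) ≠ v j (u j) := by
  suffices h : ∀ l ≤ m, ∃ u : ℕ → σ, (∀ i ≤ l, good i (u i)) ∧
      (∀ i < l, step i (u i) (u (i + 1))) ∧ ∀ i ≤ l, ∀ j < i, v i (u i) ≠ v j (u j) from
    h m le_rfl
  intro l
  induction l with
  | zero =>
    intro _
    obtain ⟨s, hs⟩ := h0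
    exact ⟨fun _ => s, fun i hi => by rwa [Nat.le_zero.1 hi], by omega, by omega⟩
  | succ l ih =>
    intro hl
    obtain ⟨u, h1, h2, h3⟩ := ih (by omega)
    obtain ⟨s', hg, hs, hv⟩ := hstep l (by omega) (u l) (h1 l le_rfl)
      ((range (l + 1)).image fun j => v j (u j)) (card_image_le.trans (by rw [card_range]; omega))
    have hne : ∀ i, i ≤ l → Function.update u (l + 1) s' i = u i := fun i hi =>
      Function.update_of_ne (by omega) _ _
    refine ⟨Function.update u (l + 1) s', ?_, ?_, ?_⟩
    · intro i hi
      rcases hi.lt_or_eq with h | rfl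
      · rw [hne i (by omega)]; exact h1 i (by omega)
      · rwa [Function.update_self]
    · intro i hi
      rw [hne i (by omega)]
      rcases (Nat.le_of_lt_succ hi).lt_or_eq with h | rfl
      · rw [hne _ (by omega)]; exact h2 i h
      · rwa [Function.update_self]
    · intro i hi j hj
      rw [hne j (by omega)]
      rcases hi.lt_or_eq with h | rfl
      · rw [hne i (by omega)]; exact h3 i (by omega) j hj
      · rw [Function.update_self]
        exact fun h => hv (mem_image.2 ⟨j, mem_range.2 hj, h.symm⟩)

theorem exists_distinct_reps {α : Type*} [DecidableEq α] (c : ℕ → Finset α) (m : ℕ)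
    (h : ∀ i ≤ m, m < (c i).card) :
    ∃ x : ℕ → α, (∀ i ≤ m, x i ∈ c i) ∧ ∀ i ≤ m, ∀ j < i, x i ≠ x j := by
  obtain ⟨u, h1, -, h2⟩ := exists_seq (fun i x => x ∈ c i) (fun _ _ _ => True) (fun _ x => x) m
    (card_pos.1 ((Nat.zero_le _).trans_lt (h 0 (Nat.zero_le _)))) (fun i hi s _ W hW => by
      obtain ⟨x, hx, hxW⟩ := exists_mem_notMem_of_card_lt_card (hW.trans_lt (h (i + 1) hi))
      exact ⟨x, hx, trivial, hxW⟩)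
  exact ⟨u, h1, h2⟩

theorem not_cycleFree_of_seq {k t n K : ℕ} (ht : 2 ≤ t) {H : Finset (Finset (Fin n))}
    (hH : ∀ e ∈ H, e.card = k) (hK : 2 * (2 * t + 1) * k ≤ K) (x y : ℕ → Fin n)
    (hx : ∀ i < t, ∀ j < i, x i ≠ x j) (hy : ∀ i ≤ t, ∀ j < i, y i ≠ y j)
    (hxy : ∀ i < t, ∀ j ≤ t, x i ≠ y j)
    (hker : ∀ i < t, IsKernel H K {x i, y i} ∧ IsKernel H K {x i, y (i + 1)})
    {E : Finset (Fin n)} (hE : E ∈ H) (hE0 : y 0 ∈ E) (hEt : y t ∈ E) (hEx : ∀ i < t, x i ∉ E)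
    (hEy : ∀ i < t, 0 < i → y i ∉ E) : ¬ CycleFree k t H := by
  refine not_cycleFree_of_path ht hH hK (fun i => {x i}) (fun i => {y i}) ?_ ?_ ?_ (by simp)
    (by simp) ?_ hE ?_ ?_ ?_ ?_
  · simpa using hx
  · simpa using hy
  · simpa using hxy
  · intro i hi
    have := hker i hi
    rw [pair_comm] at this
    simpa [← insert_eq] using this
  · simpa
  · simpa
  · simpa
  · simpa

/-- A dense bipartite relation contains a long path. -/
theorem exists_alternating_path {n m : ℕ} (P : Finset (Fin n × Fin n))
    (hP : (m + 1) * (2 * n) < P.card) :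
    ∃ z : ℕ → Fin n, (∀ i < m, (Even i → (z i, z (i + 1)) ∈ P) ∧
      (¬ Even i → (z (i + 1), z i) ∈ P)) ∧ ∀ i ≤ m, ∀ j < i, z i ≠ z j := by
  have hinj : Function.Injective fun (p : Fin n × Fin n) (i : Fin 2) =>
      if i = 0 then p.1 else p.2 := by
    intro p q h
    exact Prod.ext (by simpa using congrFun h 0) (by simpa using congrFun h 1)
  obtain ⟨𝓕, hs, ⟨F₀, hF₀⟩, hfull⟩ := exists_full (B := univ)
    (𝓕 := P.image fun p (i : Fin 2) => if i = 0 then p.1 else p.2) (fun _ _ _ => mem_univ _)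
    {{0}, {1}} (m + 1) (by
      rw [card_image_of_injective _ hinj, sum_pair (by decide)]
      simpa [two_mul] using hP)
  have hmem : ∀ F ∈ 𝓕, (F 0, F 1) ∈ P := by
    intro F hF
    obtain ⟨p, hp, rfl⟩ := mem_image.1 (hs hF)
    simpa
  have h0 : Movable 𝓕 (m + 1) {0} := movable_singleton (hfull {0} (by simp))
  have h1 : Movable 𝓕 (m + 1) {1} := movable_singleton (hfull {1} (by simp))
  obtain ⟨z, -, hz, hzne⟩ := exists_seq
    (fun i a => (Even i → ∃ F ∈ 𝓕, F 0 = a) ∧ (¬ Even i → ∃ F ∈ 𝓕, F 1 = a))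
    (fun i a b => (Even i → (a, b) ∈ P) ∧ (¬ Even i → (b, a) ∈ P)) (fun _ a => a) m
    ⟨F₀ 0, fun _ => ⟨F₀, hF₀, rfl⟩, fun h => absurd Even.zero h⟩ (fun i _ a ha W hW => by
      by_cases hi : Even i
      · obtain ⟨F, hF, rfl⟩ := ha.1 hi
        obtain ⟨G, hG, hGF, hGW⟩ := h1 F hF W (by omega)
        have h01 : G 0 = F 0 := hGF 0 (by simp)
        refine ⟨G 1, ⟨fun h => absurd hi (Nat.even_add_one.1 h), fun _ => ⟨G, hG, rfl⟩⟩,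
          ⟨fun _ => h01 ▸ hmem G hG, fun h => absurd hi h⟩, hGW 1 (by simp)⟩
      · obtain ⟨F, hF, rfl⟩ := ha.2 hi
        obtain ⟨G, hG, hGF, hGW⟩ := h0 F hF W (by omega)
        have h01 : G 1 = F 1 := hGF 1 (by simp)
        refine ⟨G 0, ⟨fun _ => ⟨G, hG, rfl⟩, fun h => absurd (Nat.even_add_one.2 hi) h⟩,
          ⟨fun h => absurd h hi, fun _ => h01 ▸ hmem G hG⟩, hGW 0 (by simp)⟩)
  exact ⟨z, hz, hzne⟩

open Classical in
/-- The vertices in whose core `f` lies. -/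
noncomputable def centers {V : Type*} [Fintype V] [DecidableEq V] (H : Finset (Finset V)) (D : ℕ)
    (f : Finset V) : Finset V :=
  {x | InCore H D x f}

theorem mem_centers {V : Type*} [Fintype V] [DecidableEq V] {H : Finset (Finset V)} {D : ℕ}
    {f : Finset V} {x : V} : x ∈ centers H D f ↔ InCore H D x f := by
  simp [centers]

theorem card_centers_mul_le {k t n D : ℕ} (hk : 4 ≤ k) (ht : 2 ≤ t) (hD : 2 * (2 * t + 1) * k < D)
    {H : Finset (Finset (Fin n))} (hH : ∀ e ∈ H, e.card = k) (hfree : CycleFree k t H)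
    (f : Finset (Fin n)) : (centers H D f).card * D ≤ 16 * (t + 1) * n := by
  classical
  rcases (centers H D f).eq_empty_or_nonempty with he | ⟨x₀, hx₀⟩
  · simp [he]
  rw [mem_centers] at hx₀
  have hfc : f.card + 1 = k := by rw [← hH _ hx₀.insert_mem, card_insert_of_notMem hx₀.notMem]
  obtain ⟨y₀, hy₀, y₁, hy₁, hy01⟩ := one_lt_card.1 (show 1 < f.card by omega)
  rcases Nat.lt_or_ge 1 (centers H D f).card with h1 | h1
  swap
  · have h2 := (hx₀.le_card hy₀).trans (Set.ncard_le_card _)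
    rw [Nat.card_fin] at h2
    calc (centers H D f).card * D ≤ 1 * n := Nat.mul_le_mul h1 h2
      _ ≤ _ := Nat.mul_le_mul_right _ (by omega)
  by_contra! hlt
  let P : Finset (Fin n × Fin n) := {p ∈ (centers H D f).erase x₀ ×ˢ univ |
    p.2 ∉ insert x₀ f ∧ IsKernel H (2 * (2 * t + 1) * k) {p.1, p.2}}
  have hP : ((centers H D f).card - 1) * (D - k) ≤ P.card := by
    rw [← card_erase_of_mem (mem_centers.2 hx₀), card_filter, sum_product]
    refine card_nsmul_le_sum _ _ _ fun x hx => ?_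
    rw [← card_filter]
    have hxc := mem_centers.1 (mem_of_mem_erase hx)
    have h2 := hxc.le_card hy₀
    rw [Set.ncard_eq_toFinset_card'] at h2
    have h3 := le_card_sdiff (insert x₀ f) {z | InCore H D x (insert z (f.erase y₀))}.toFinset
    rw [card_insert_of_notMem hx₀.notMem, hfc] at h3
    refine le_trans (by omega) (h3.trans (card_le_card fun z hz => ?_))
    rw [mem_sdiff, Set.mem_toFinset] at hz
    exact mem_filter.2 ⟨mem_univ _, hz.2, hz.1.isKernel hD (mem_insert_self _ _)⟩
  have hDk : 4 * k ≤ D := by nlinarith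
  have hPc : (2 * t + 1) * (2 * n) < P.card := by
    refine lt_of_lt_of_le ?_ hP
    obtain ⟨a, ha⟩ : ∃ a, (centers H D f).card = a + 1 := ⟨_, (Nat.sub_add_cancel h1.le).symm⟩
    obtain ⟨b, rfl⟩ : ∃ b, D = k + b := ⟨_, (Nat.add_sub_cancel' (by omega)).symm⟩
    rw [ha] at hlt h1 ⊢
    rw [Nat.add_sub_cancel, Nat.add_sub_cancel_left]
    have h4 : (a + 1) * (k + b) ≤ (2 * a) * (2 * b) := Nat.mul_le_mul (by omega) (by omega)
    nlinarith
  obtain ⟨z, hz, hzne⟩ := exists_alternating_path P hPc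
  have hmemP : ∀ p ∈ P, InCore H D p.1 f ∧ p.1 ≠ x₀ ∧ p.2 ≠ x₀ ∧ p.2 ∉ f ∧
      IsKernel H (2 * (2 * t + 1) * k) {p.1, p.2} := by
    intro p hp
    simp only [P, mem_filter, mem_product, mem_erase, mem_centers, mem_insert, not_or] at hp
    tauto
  have he : ∀ i < t, InCore H D (z (2 * i)) f ∧ z (2 * i) ≠ x₀ ∧ z (2 * i + 1) ≠ x₀ ∧
      z (2 * i + 1) ∉ f ∧ IsKernel H (2 * (2 * t + 1) * k) {z (2 * i), z (2 * i + 1)} := by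
    intro i hi
    exact hmemP _ ((hz (2 * i) (by omega)).1 (even_two_mul i))
  have ho : ∀ i, i + 1 < t → IsKernel H (2 * (2 * t + 1) * k) {z (2 * (i + 1)), z (2 * i + 1)} := by
    intro i hi
    exact (hmemP _ ((hz (2 * i + 1) (by omega)).2 (by simp))).2.2.2.2
  have hzne' : ∀ i ≤ 2 * t, ∀ j ≤ 2 * t, i ≠ j → z i ≠ z j := by
    intro i hi j hj hij
    rcases Nat.lt_or_gt_of_ne hij with h | h
    · exact (hzne j hj i h).symm
    · exact hzne i hi j h
  have hzf : ∀ i < t, z (2 * i) ∉ f := fun i hi => (he i hi).1.notMem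
  have hyt : ∀ i, 0 < i → i < t → ∃ j, i = j + 1 ∧ j + 1 < t :=
    fun i h h' => ⟨i - 1, by omega, by omega⟩
  let y : ℕ → Fin n := fun j => if j = 0 then y₀ else if j = t then y₁ else z (2 * (j - 1) + 1)
  have hy0 : y 0 = y₀ := rfl
  have hyt' : y t = y₁ := by simp [y]; omega
  have hyi : ∀ j, j + 1 < t → y (j + 1) = z (2 * j + 1) := by
    intro j hj
    simp only [y]
    rw [if_neg (by omega), if_neg (by omega), Nat.add_sub_cancel]
  have hyc : ∀ j ≤ t, j = 0 ∨ j = t ∨ ∃ i, i + 1 < t ∧ j = i + 1 := fun j hj => by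
    rcases Nat.eq_zero_or_pos j with h | h
    · exact Or.inl h
    · rcases hj.lt_or_eq with h' | h'
      · exact Or.inr (Or.inr ⟨j - 1, by omega, by omega⟩)
      · exact Or.inr (Or.inl h')
  refine not_cycleFree_of_seq ht hH le_rfl (fun i => z (2 * i)) y ?_ ?_ ?_ ?_ hx₀.insert_mem ?_ ?_
    ?_ ?_ hfree
  · intro i hi j hj
    exact hzne' _ (by omega) _ (by omega) (by omega)
  · intro i hi j hj
    rcases hyc i hi with rfl | rfl | ⟨i, hi', rfl⟩
    · omega
    · rcases hyc j hj.le with rfl | rfl | ⟨j, hj', rfl⟩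
      · rw [hy0, hyt']; exact hy01.symm
      · omega
      · rw [hyt', hyi j hj']
        rintro rfl
        exact (he j (by omega)).2.2.2.1 hy₁
    · rcases hyc j (by omega) with rfl | rfl | ⟨j, hj', rfl⟩
      · rw [hy0, hyi i hi']
        rintro rfl
        exact (he i (by omega)).2.2.2.1 hy₀
      · omega
      · rw [hyi i hi', hyi j hj']
        exact hzne' _ (by omega) _ (by omega) (by omega)
  · intro i hi j hj
    rcases hyc j hj with rfl | rfl | ⟨j, hj', rfl⟩
    · rw [hy0]; rintro rfl; exact hzf i hi hy₀
    · rw [hyt']; rintro rfl; exact hzf i hi hy₁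
    · rw [hyi j hj']; exact hzne' _ (by omega) _ (by omega) (by omega)
  · intro i hi
    constructor
    · rcases hyc i hi.le with rfl | rfl | ⟨j, hj', rfl⟩
      · exact (he 0 hi).1.isKernel hD hy₀
      · omega
      · rw [hyi j hj']; exact ho j hj'
    · rcases hyc (i + 1) hi with h | h | ⟨j, hj', h⟩
      · omega
      · rw [h, hyt']; exact (he i hi).1.isKernel hD hy₁
      · obtain rfl : i = j := by omega
        rw [hyi i hj']; exact (he i hi).2.2.2.2
  · rw [hy0]; exact mem_insert_of_mem hy₀
  · rw [hyt']; exact mem_insert_of_mem hy₁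
  · intro i hi
    rw [mem_insert, not_or]
    exact ⟨(he i hi).2.1, hzf i hi⟩
  · intro i hi hi0
    obtain ⟨j, rfl, hj⟩ := hyt i hi0 hi
    rw [hyi j hj, mem_insert, not_or]
    exact ⟨(he j (by omega)).2.2.1, (he j (by omega)).2.2.2.1⟩

theorem exists_movable_subfamily {m n L : ℕ} {B : Finset (Fin n)} {𝓕 : Finset (Fin m → Fin n)}
    (hB : ∀ F ∈ 𝓕, ∀ i, F i ∈ B) (hc : L * m * B.card ^ (m - 1) < 𝓕.card) :
    ∃ 𝓕' ⊆ 𝓕, 𝓕'.Nonempty ∧ ∀ A, Movable 𝓕' L A := by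
  obtain ⟨𝓕', hs, hne, h⟩ := exists_full hB (univ.image fun i => ({i} : Finset (Fin m))) L (by
    rw [sum_image (fun i _ j _ h => singleton_injective h)]
    simpa [mul_assoc] using hc)
  refine ⟨𝓕', hs, hne, fun A => ?_⟩
  have := Movable.biUnion A (fun i => ({i} : Finset (Fin m))) (𝓕 := 𝓕') (D := L)
    fun i _ => movable_singleton (h {i} (mem_image_of_mem _ (mem_univ i)))
  simpa using this

theorem card_many_centers_le {k t : ℕ} (hk : 4 ≤ k) (ht : 2 ≤ t) :
    ∃ C : ℕ, ∀ D, 2 * (2 * t + 1) * k < D → ∀ (n : ℕ) (H : Finset (Finset (Fin n))),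
      (∀ e ∈ H, e.card = k) → CycleFree k t H →
      ({f ∈ powersetCard (k - 1) (univ : Finset (Fin n)) |
        t + 1 ≤ (centers H D f).card}).card ≤ C * n ^ (k - 2) := by
  obtain ⟨m, rfl⟩ : ∃ m, k = m + 1 := ⟨k - 1, by omega⟩
  refine ⟨(m + 1) ^ (m + (t + 1)) * ((t + 2) * m), fun D hD n H hH hfree => ?_⟩
  rw [Nat.add_sub_cancel, show m + 1 - 2 = m - 1 by omega]
  by_contra! hlt
  have hex : ∀ f : Finset (Fin n), ∃ T, t + 1 ≤ (centers H D f).card →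
      T ⊆ centers H D f ∧ T.card = t + 1 := by
    intro f
    by_cases h : t + 1 ≤ (centers H D f).card
    · obtain ⟨T, hT⟩ := exists_subset_card_eq h
      exact ⟨T, fun _ => hT⟩
    · exact ⟨∅, fun h' => absurd h' h⟩
  choose c' hc' using hex
  obtain ⟨𝓕₀, hp₀, him₀, hcol₀, hcard⟩ := exists_partite (m := m) (d := t + 1) (by omega)
    (H := {f ∈ powersetCard m univ | t + 1 ≤ (centers H D f).card})
    (fun e he => (mem_powersetCard.1 (mem_filter.1 he).1).2) c' (fun e he => by
      obtain ⟨h1, h2⟩ := hc' e (mem_filter.1 he).2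
      exact ⟨h2.le, disjoint_right.2 fun v hv => (mem_centers.1 (h1 hv)).notMem⟩)
  have hlt' := hlt.trans_le hcard
  rw [mul_assoc] at hlt'
  obtain ⟨𝓕, hs, ⟨F₀, hF₀⟩, hmv⟩ := exists_movable_subfamily (B := univ) (L := t + 2)
    (𝓕 := 𝓕₀) (fun _ _ _ => mem_univ _)
    (by rw [card_univ, Fintype.card_fin]; exact Nat.lt_of_mul_lt_mul_left hlt')
  have hp := hp₀.mono hs
  have hcol : ∀ F ∈ 𝓕, ∀ G ∈ 𝓕, ∀ i, F i ∉ c' (univ.image G) :=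
    fun F hF G hG => hcol₀ F (hs hF) G (hs hG)
  have hc : ∀ F ∈ 𝓕, (c' (univ.image F)).card = t + 1 ∧
      ∀ x ∈ c' (univ.image F), InCore H D x (univ.image F) := by
    intro F hF
    obtain ⟨h1, h2⟩ := hc' _ (mem_filter.1 (him₀ F (hs hF))).2
    exact ⟨h2, fun x hx => mem_centers.1 (h1 hx)⟩
  let p₀ : Fin m := ⟨0, by omega⟩
  let p : ℕ → Fin m := fun i => if Even i then ⟨1, by omega⟩ else ⟨2, by omega⟩
  have hpp : ∀ i, p (i + 1) ≠ p i := by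
    intro i
    by_cases h : Even i <;> simp [p, h, Nat.even_add_one]
  have hp0 : ∀ i, p i ≠ p₀ := by
    intro i
    by_cases h : Even i <;> simp [p, p₀, h]
  obtain ⟨F, hF, hstep, hFne⟩ := exists_seq (fun _ F => F ∈ 𝓕 ∧ F p₀ = F₀ p₀)
    (fun i F F' => F' (p i) = F (p i)) (fun i F => F (p i)) (t - 1) ⟨F₀, hF₀, rfl⟩
    (fun i _ F hF W hW => by
      obtain ⟨F', hF', h1, h2⟩ := hmv {p (i + 1)} F hF.1 W (by omega)
      refine ⟨F', ⟨hF', ?_⟩, h1 _ (by simpa using (hpp i).symm), h2 _ (by simp)⟩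
      rw [← hF.2]
      exact h1 _ (by simpa using (hp0 _).symm))
  let y : ℕ → Fin n := fun i => if i = 0 then F₀ p₀ else F (i - 1) (p (i - 1))
  have hy0 : y 0 = F₀ p₀ := rfl
  have hyS : ∀ i, y (i + 1) = F i (p i) := fun i => by simp [y]
  have hymem : ∀ j ≤ t, ∃ G ∈ 𝓕, ∃ l, y j = G l := by
    intro j hj
    rcases j with _ | j
    · exact ⟨F₀, hF₀, _, hy0⟩
    · exact ⟨F j, (hF j (by omega)).1, _, hyS j⟩
  have hyne : ∀ i ≤ t, ∀ j < i, y i ≠ y j := by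
    intro i hi j hj
    rcases i with _ | i
    · omega
    rcases j with _ | j
    · rw [hyS, hy0]
      exact fun h => hp0 i (hp _ (hF i (by omega)).1 _ hF₀ _ _ h)
    · rw [hyS, hyS]
      exact hFne i (by omega) j (by omega)
  obtain ⟨Fc, hFc, hFc1, hFc2⟩ := hmv {p₀, p (t - 1)}ᶜ (F (t - 1)) (hF _ le_rfl).1
    ((range (t + 1)).image y) (card_image_le.trans_lt (by rw [card_range]; omega))
  have hFc0 : Fc p₀ = y 0 := by
    rw [hFc1 _ (by simp), (hF _ le_rfl).2, hy0]
  have hFct : Fc (p (t - 1)) = y t := by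
    obtain ⟨s, rfl⟩ : ∃ s, t = s + 1 := ⟨t - 1, by omega⟩
    rw [hFc1 _ (by simp), hyS]; rfl
  let G : ℕ → Fin m → Fin n := fun i => if i < t then F i else Fc
  have hG : ∀ i ≤ t, G i ∈ 𝓕 := by
    intro i hi
    simp only [G]
    split_ifs with h
    · exact (hF i (by omega)).1
    · exact hFc
  have hGi : ∀ i < t, G i = F i := fun i hi => if_pos hi
  have hGt : G t = Fc := if_neg (lt_irrefl t)
  obtain ⟨x, hx, hxne⟩ := exists_distinct_reps (fun i => c' (univ.image (G i))) t
    (fun i hi => by rw [(hc _ (hG i hi)).1]; omega)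
  have hxcore : ∀ i ≤ t, InCore H D (x i) (univ.image (G i)) := fun i hi =>
    (hc _ (hG i hi)).2 _ (hx i hi)
  have hxF : ∀ i ≤ t, ∀ F ∈ 𝓕, ∀ l, x i ≠ F l := by
    intro i hi F hF l h
    exact hcol F hF _ (hG i hi) l (h ▸ hx i hi)
  have hyE : ∀ l, Fc l = y 0 ∨ Fc l = y t ∨ ∀ i ≤ t, Fc l ≠ y i := by
    intro l
    by_cases h0 : l = p₀
    · exact Or.inl (h0 ▸ hFc0)
    by_cases h1 : l = p (t - 1)
    · exact Or.inr (Or.inl (h1 ▸ hFct))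
    · exact Or.inr (Or.inr fun i hi h => hFc2 l (by simp [h0, h1])
        (h ▸ mem_image_of_mem _ (mem_range.2 (by omega))))
  have hEcore := hxcore t le_rfl
  rw [hGt] at hEcore
  refine not_cycleFree_of_seq ht hH le_rfl x y (fun i hi => hxne i hi.le) hyne ?_ ?_
    hEcore.insert_mem ?_ ?_ ?_ ?_ hfree
  · intro i hi j hj
    obtain ⟨F', hF', l, h⟩ := hymem j hj
    rw [h]; exact hxF i hi.le F' hF' l
  · intro i hi
    have h := hxcore i hi.le
    rw [hGi i hi] at h
    refine ⟨h.isKernel hD ?_, h.isKernel hD ?_⟩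
    · rcases i with _ | j
      · rw [hy0, ← (hF 0 (Nat.zero_le _)).2]; exact mem_image_of_mem _ (mem_univ _)
      · rw [hyS, ← hstep j (by omega)]; exact mem_image_of_mem _ (mem_univ _)
    · rw [hyS]; exact mem_image_of_mem _ (mem_univ _)
  · rw [← hFc0]; exact mem_insert_of_mem (mem_image_of_mem _ (mem_univ _))
  · rw [← hFct]; exact mem_insert_of_mem (mem_image_of_mem _ (mem_univ _))
  · intro i hi
    rw [mem_insert, not_or]
    refine ⟨(hxne t le_rfl i hi).symm, fun h => ?_⟩
    obtain ⟨l, -, hl⟩ := mem_image.1 h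
    exact hxF i hi.le Fc hFc l hl.symm
  · intro i hi hi0
    rw [mem_insert, not_or]
    constructor
    · obtain ⟨F', hF', l, h⟩ := hymem i hi.le
      rw [h]; exact (hxF t le_rfl F' hF' l).symm
    · intro h
      obtain ⟨l, -, hl⟩ := mem_image.1 h
      rcases hyE l with h' | h' | h'
      · exact hyne i hi.le 0 hi0 (hl.symm.trans h')
      · exact hyne t le_rfl i hi (h'.symm.trans hl)
      · exact h' i hi.le hl

theorem card_le_sum_centers {k n D : ℕ} {H : Finset (Finset (Fin n))}
    (hH : ∀ e ∈ H, e.card = k) :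
    H.card ≤ ∑ f ∈ powersetCard (k - 1) univ, (centers H D f).card +
      (open Classical in {e ∈ H | ∀ x ∈ e, ¬ InCore H D x (e.erase x)}).card := by
  classical
  rw [← card_filter_add_card_filter_not (s := H)
    (fun e => ∀ x ∈ e, ¬ InCore H D x (e.erase x)), add_comm]
  refine Nat.add_le_add_right ?_ _
  rw [← card_sigma]
  have hex : ∀ e ∈ {e ∈ H | ¬ ∀ x ∈ e, ¬ InCore H D x (e.erase x)}, ∃ x ∈ e,
      InCore H D x (e.erase x) := by
    intro e he
    have := (mem_filter.1 he).2
    push Not at this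
    exact this
  let s : Finset (Σ _ : Finset (Fin n), Fin n) :=
    (powersetCard (k - 1) univ).sigma fun f => centers H D f
  refine card_le_card_of_surjOn (fun p : Σ _ : Finset (Fin n), Fin n => insert p.2 p.1)
    (s := s) fun e he => ?_
  obtain ⟨x, hx, hxc⟩ := hex e he
  have hcard := hH e (mem_filter.1 he).1
  refine ⟨⟨e.erase x, x⟩, ?_, insert_erase hx⟩
  rw [mem_coe, mem_sigma, mem_powersetCard, mem_centers]
  exact ⟨⟨subset_univ _, by rw [card_erase_of_mem hx, hcard]⟩, hxc⟩

theorem choose_le_choose_sub_add (n m s : ℕ) (hs : s ≤ n) :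
    n.choose (m + 1) ≤ (n - s).choose (m + 1) + s * n ^ m := by
  induction s with
  | zero => simp
  | succ s ih =>
    refine (ih (by omega)).trans ?_
    obtain ⟨r, hr⟩ : ∃ r, n - s = r + 1 := ⟨n - s - 1, by omega⟩
    have h1 : n - (s + 1) = r := by omega
    rw [hr, h1, Nat.choose_succ_succ']
    have h2 : r.choose m ≤ n ^ m := (Nat.choose_le_pow r m).trans (Nat.pow_le_pow_left (by omega) m)
    have h3 : (s + 1) * n ^ m = s * n ^ m + n ^ m := by ring
    omega

theorem mul_choose_add_choose_sub_le (n m t : ℕ) (ht : t ≤ n) :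
    t * n.choose (m + 1) + (n - t).choose (m + 2) ≤ n.choose (m + 2) + t ^ 2 * n ^ m := by
  induction t with
  | zero => simp
  | succ t ih =>
    have h0 := ih (by omega)
    have h2 := choose_le_choose_sub_add n m (t + 1) ht
    obtain ⟨r, hr⟩ : ∃ r, n - t = r + 1 := ⟨n - t - 1, by omega⟩
    have h1 : n - (t + 1) = r := by omega
    rw [hr, Nat.choose_succ_succ' r (m + 1)] at h0
    rw [h1] at h2 ⊢
    nlinarith [Nat.zero_le (t * n ^ m)]

/-- In an extremal hypergraph almost all `(k-1)`-sets have exactly `t` centers. -/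
theorem mul_card_centers_ne_le {k t : ℕ} (hk : 4 ≤ k) (ht : 2 ≤ t) (q : ℕ) :
    ∃ D n₀, 2 * (2 * t + 1) * k < D ∧ ∀ n ≥ n₀, ∀ H : Finset (Finset (Fin n)),
      (∀ e ∈ H, e.card = k) → CycleFree k t H → H.card = n.choose k - (n - t).choose k →
      q * ({f ∈ powersetCard (k - 1) (univ : Finset (Fin n)) |
        (centers H D f).card ≠ t}).card ≤ n ^ (k - 1) := by
  obtain ⟨C₁, hC₁⟩ := card_many_centers_le hk ht
  have hD : 2 * (2 * t + 1) * k <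
      2 * (q * (C₁ * (16 * (t + 1)))) + 2 * (2 * t + 1) * k + 1 := by omega
  generalize hDdef : 2 * (q * (C₁ * (16 * (t + 1)))) + 2 * (2 * t + 1) * k + 1 = D at hD
  obtain ⟨C, hC⟩ := card_coreless_le hk ht hD
  refine ⟨D, 2 * (q * (C + t ^ 2 + C₁)) + t, hD, fun n hn H hH hfree hcard => ?_⟩
  have h1 := hC₁ D hD n H hH hfree
  have h2 := hC n H hH hfree
  have h3 := card_le_sum_centers (D := D) hH
  have hpow : n ^ (k - 1) = n * n ^ (k - 2) := by
    rw [← pow_succ']; congr 1; omega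
  have h4 : t * n.choose (k - 1) ≤ H.card + t ^ 2 * n ^ (k - 2) := by
    have := mul_choose_add_choose_sub_le n (k - 2) t (by omega)
    rw [show k - 2 + 1 = k - 1 by omega, show k - 2 + 2 = k by omega] at this
    omega
  set P := powersetCard (k - 1) (univ : Finset (Fin n)) with hP
  have hPc : P.card = n.choose (k - 1) := by rw [hP, card_powersetCard, card_univ, Fintype.card_fin]
  set S := ∑ f ∈ P with t + 1 ≤ (centers H D f).card, (centers H D f).card with hS
  have h5 : ∑ f ∈ P, (centers H D f).card + ({f ∈ P | (centers H D f).card < t}).card ≤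
      t * P.card + S := by
    rw [hS, sum_filter, card_filter, ← sum_add_distrib, mul_comm, ← smul_eq_mul, ← sum_const,
      ← sum_add_distrib]
    refine sum_le_sum fun f _ => ?_
    split_ifs <;> omega
  have h6 : S * D ≤ C₁ * (16 * (t + 1)) * n ^ (k - 1) := by
    rw [hS, sum_mul]
    refine (sum_le_card_nsmul _ _ (16 * (t + 1) * n) fun f _ =>
      card_centers_mul_le hk ht hD hH hfree f).trans ?_
    rw [smul_eq_mul, hpow]
    calc _ ≤ (C₁ * n ^ (k - 2)) * (16 * (t + 1) * n) := Nat.mul_le_mul_right _ h1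
      _ = _ := by ring
  have h7 : 2 * (q * S) ≤ n ^ (k - 1) := by
    refine Nat.le_of_mul_le_mul_right (c := D) ?_ (by omega)
    calc 2 * (q * S) * D = 2 * q * (S * D) := by ring
      _ ≤ 2 * q * (C₁ * (16 * (t + 1)) * n ^ (k - 1)) := Nat.mul_le_mul_left _ h6
      _ = n ^ (k - 1) * (2 * (q * (C₁ * (16 * (t + 1))))) := by ring
      _ ≤ _ := Nat.mul_le_mul_left _ (by omega)
  have h8 : ({f ∈ P | (centers H D f).card ≠ t}).card ≤ ({f ∈ P | (centers H D f).card < t}).card +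
      ({f ∈ P | t + 1 ≤ (centers H D f).card}).card := by
    refine (card_le_card fun f hf => ?_).trans (card_union_le _ _)
    simp only [mem_filter, mem_union] at hf ⊢
    rcases Nat.lt_or_gt_of_ne hf.2 with h | h
    · exact Or.inl ⟨hf.1, h⟩
    · exact Or.inr ⟨hf.1, h⟩
  have h9 : ({f ∈ P | (centers H D f).card < t}).card ≤ S + (C + t ^ 2) * n ^ (k - 2) := by
    rw [hPc] at h5
    rw [add_mul]
    omega
  have h10 : 2 * (q * (C + t ^ 2 + C₁)) * n ^ (k - 2) ≤ n ^ (k - 1) := by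
    rw [hpow]
    exact Nat.mul_le_mul_right _ (by omega)
  have h11 := Nat.mul_le_mul_left q (h8.trans (add_le_add h9 h1))
  nlinarith

theorem centers_eq_of_common {k t n D : ℕ} (hk : 4 ≤ k) (ht : 2 ≤ t)
    (hD : 2 * (2 * t + 1) * k < D) {H : Finset (Finset (Fin n))} (hH : ∀ e ∈ H, e.card = k)
    (hfree : CycleFree k t H) {W : Finset (Fin n)} (hWc : 2 * k + t ≤ W.card)
    (hW : ∀ f ⊆ W, f.card = k - 1 → (centers H D f).card = t ∧ Disjoint (centers H D f) W)
    {f f' : Finset (Fin n)} (hf : f ⊆ W) (hfc : f.card = k - 1) (hf' : f' ⊆ W)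
    (hfc' : f'.card = k - 1) {y₀ : Fin n} (hy₀ : y₀ ∈ f) (hy₀' : y₀ ∈ f') :
    centers H D f = centers H D f' := by
  by_contra hne
  have hcf := hW f hf hfc
  have hcf' := hW f' hf' hfc'
  obtain ⟨xs, hxs, hxs'⟩ := not_subset.1 fun h =>
    hne (eq_of_subset_of_card_le h (by rw [hcf.1, hcf'.1]))
  obtain ⟨y₁, hy₁, hy₁'⟩ := not_subset.1 fun h : f ⊆ f' =>
    hne (by rw [eq_of_subset_of_card_le h (by rw [hfc, hfc'])])
  obtain ⟨yt, hyt, hyt0⟩ := exists_mem_ne (by omega : 1 < f'.card) y₀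
  obtain ⟨z, hz, hzne⟩ := exists_distinct_reps (fun _ => W \ (f ∪ f')) t (fun _ _ => by
    have h1 := le_card_sdiff (f ∪ f') W
    have h2 := card_union_le f f'
    omega)
  simp only [mem_sdiff, mem_union, not_or] at hz
  let y : ℕ → Fin n := fun i =>
    if i = 0 then y₀ else if i = 1 then y₁ else if i = t then yt else z i
  have hy0 : y 0 = y₀ := rfl
  have hy1 : y 1 = y₁ := rfl
  have hyt' : y t = yt := by
    simp only [y]; rw [if_neg (by omega), if_neg (by omega)]; simp
  have hyW : ∀ i ≤ t, y i ∈ W := by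
    intro i hi
    simp only [y]
    split_ifs
    · exact hf hy₀
    · exact hf hy₁
    · exact hf' hyt
    · exact (hz i hi).1
  have hyne : ∀ i ≤ t, ∀ j < i, y i ≠ y j := by
    intro i hi j hj
    have hzi := hz i hi
    have hzj := hz j (by omega)
    have hzz := hzne i hi j hj
    simp only [y]
    split_ifs <;> grind
  have hyf' : ∀ i < t, 0 < i → y i ∉ f' := by
    intro i hi hi0
    simp only [y]
    rw [if_neg (by omega)]
    split_ifs
    · exact hy₁'
    · omega
    · exact (hz i hi.le).2.2
  have hg : ∀ i < t, ∃ g ⊆ W, g.card = k - 1 ∧ y i ∈ g ∧ y (i + 1) ∈ g ∧ (i = 0 → g = f) := by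
    intro i hi
    rcases Nat.eq_zero_or_pos i with rfl | hi0
    · exact ⟨f, hf, hfc, by rwa [hy0], by rwa [hy1], fun _ => rfl⟩
    · have hsub : {y i, y (i + 1)} ⊆ W := by
        simp [insert_subset_iff, hyW i hi.le, hyW (i + 1) hi]
      obtain ⟨g, hg1, hg2, hg3⟩ := exists_subsuperset_card_eq (n := k - 1) hsub
        (card_le_two.trans (by omega)) (by omega)
      exact ⟨g, hg2, hg3, hg1 (by simp), hg1 (by simp), fun h => by omega⟩
  choose! g hgW hgc hgy hgy' hg0 using hg
  obtain ⟨x, hx, -, hxne⟩ := exists_seq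
    (fun i x => x ∈ centers H D (g i) ∧ (i = 0 → x ∉ centers H D f')) (fun _ _ _ => True)
    (fun _ x => x) (t - 1) ⟨xs, by rwa [hg0 0 (by omega) rfl], fun _ => hxs'⟩
    (fun i hi s _ X hX => by
      obtain ⟨x, hx, hxX⟩ := exists_mem_notMem_of_card_lt_card (s := X)
        (t := centers H D (g (i + 1)))
        (by rw [(hW _ (hgW _ (by omega)) (hgc _ (by omega))).1]; omega)
      exact ⟨x, ⟨hx, by omega⟩, trivial, hxX⟩)
  obtain ⟨xc, hxc, hxcn⟩ := exists_mem_notMem_of_card_lt_card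
    (s := (range (t - 1)).image fun i => x (i + 1)) (t := centers H D f')
    (card_image_le.trans_lt (by rw [card_range, hcf'.1]; omega))
  have hxcne : ∀ i < t, x i ≠ xc := by
    intro i hi h
    rcases i with _ | i
    · exact (hx 0 (by omega)).2 rfl (h ▸ hxc)
    · exact hxcn (mem_image.2 ⟨i, mem_range.2 (by omega), h⟩)
  have hxW : ∀ i < t, x i ∉ W := fun i hi =>
    disjoint_left.1 (hW _ (hgW i hi) (hgc i hi)).2 (hx i (by omega)).1
  have hxcW : xc ∉ W := disjoint_left.1 hcf'.2 hxc
  refine not_cycleFree_of_seq ht hH le_rfl x y (fun i hi => hxne i (by omega)) hyne ?_ ?_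
    (mem_centers.1 hxc).insert_mem ?_ ?_ ?_ ?_ hfree
  · intro i hi j hj h
    exact hxW i hi (h ▸ hyW j hj)
  · intro i hi
    have h := mem_centers.1 (hx i (by omega)).1
    exact ⟨h.isKernel hD (hgy i hi), h.isKernel hD (hgy' i hi)⟩
  · rw [hy0]; exact mem_insert_of_mem hy₀'
  · rw [hyt']; exact mem_insert_of_mem hyt
  · intro i hi
    rw [mem_insert, not_or]
    exact ⟨hxcne i hi, fun h => hxW i hi (hf' h)⟩
  · intro i hi hi0
    rw [mem_insert, not_or]
    exact ⟨fun h => hxcW (h ▸ hyW i hi.le), hyf' i hi hi0⟩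

theorem centers_eq_of_subset {k t n D : ℕ} (hk : 4 ≤ k) (ht : 2 ≤ t)
    (hD : 2 * (2 * t + 1) * k < D) {H : Finset (Finset (Fin n))} (hH : ∀ e ∈ H, e.card = k)
    (hfree : CycleFree k t H) {W : Finset (Fin n)} (hWc : 2 * k + t ≤ W.card)
    (hW : ∀ f ⊆ W, f.card = k - 1 → (centers H D f).card = t ∧ Disjoint (centers H D f) W)
    {f f' : Finset (Fin n)} (hf : f ⊆ W) (hfc : f.card = k - 1) (hf' : f' ⊆ W)
    (hfc' : f'.card = k - 1) : centers H D f = centers H D f' := by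
  obtain ⟨a, ha⟩ := card_pos.1 (by omega : 0 < f.card)
  obtain ⟨b, hb⟩ := card_pos.1 (by omega : 0 < f'.card)
  obtain ⟨h, h1, h2, h3⟩ := exists_subsuperset_card_eq (n := k - 1)
    (show {a, b} ⊆ W by simp [insert_subset_iff, hf ha, hf' hb])
    (card_le_two.trans (by omega)) (by omega)
  exact (centers_eq_of_common hk ht hD hH hfree hWc hW hf hfc h2 h3 ha (h1 (by simp))).trans
    (centers_eq_of_common hk ht hD hH hfree hWc hW h2 h3 hf' hfc' (h1 (by simp)) hb)

section badTuples
variable {ι : Type*} [Fintype ι] [DecidableEq ι] {n : ℕ}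

theorem mul_le_of_le_add_parts {q x a b N : ℕ} (h : x ≤ a + b) (ha : 2 * (q * a) ≤ N)
    (hb : 2 * (q * b) ≤ N) : q * x ≤ N := by
  have := Nat.mul_le_mul_left q h
  rw [mul_add] at this
  omega

theorem card_tuples_eq_le {i j : ι} (hij : i ≠ j) :
    ({T : ι → Fin n | T i = T j} : Finset (ι → Fin n)).card ≤ n ^ (Fintype.card ι - 1) := by
  have h := card_le_of_card_fiber_le (B := univ) (R := {T : ι → Fin n | T i = T j}) (A := {j})
    (D := 1) (fun _ _ _ => mem_univ _) (fun T _ => card_le_one.2 fun F hF G hG => by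
      simp only [mem_fiber, mem_filter, mem_univ, true_and, mem_singleton] at hF hG
      funext l
      by_cases hl : l = j
      · rw [hl, ← hF.1, ← hG.1, hF.2 i hij, hG.2 i hij]
      · rw [hF.2 l hl, hG.2 l hl])
  simpa using h

theorem card_tuples_mem_le (c : Finset (Fin n) → Finset (Fin n)) (t : ℕ) {A : Finset ι} {j : ι}
    (hj : j ∉ A) :
    ({T : ι → Fin n | (c (A.image T)).card = t ∧ T j ∈ c (A.image T)} :
      Finset (ι → Fin n)).card ≤ t * n ^ (Fintype.card ι - 1) := by
  have h := card_le_of_card_fiber_le (B := univ)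
    (R := {T : ι → Fin n | (c (A.image T)).card = t ∧ T j ∈ c (A.image T)}) (A := {j})
    (D := t) (fun _ _ _ => mem_univ _) (fun T hT => by
      rw [← (mem_filter.1 hT).2.1]
      have himg : ∀ F : ι → Fin n, (∀ l ∉ ({j} : Finset ι), F l = T l) → A.image F = A.image T :=
        fun F hF => image_congr fun l hl => hF l (by
          rw [mem_singleton]; rintro rfl; exact hj hl)
      refine card_le_card_of_injOn (fun F => F j) (fun F hF => ?_) fun F hF G hG h => ?_
      · rw [mem_coe, mem_fiber, mem_filter] at hF
        rw [← himg F hF.2]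
        exact hF.1.2.2
      · rw [mem_coe, mem_fiber] at hF hG
        funext l
        by_cases hl : l = j
        · subst hl; exact h
        · rw [hF.2 l (by simpa), hG.2 l (by simpa)])
  simpa using h

theorem card_tuples_image_mem_le (m : ℕ) (𝓑 : Finset (Finset (Fin n))) (h𝓑 : ∀ f ∈ 𝓑, f.card = m)
    {A : Finset ι} (hA : A.card = m) :
    ({T : ι → Fin n | A.image T ∈ 𝓑} : Finset (ι → Fin n)).card ≤
      m ^ m * 𝓑.card * n ^ (Fintype.card ι - m) := by
  have h := card_le_of_card_fiber_le (B := univ)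
    (R := {T : ι → Fin n | A.image T ∈ 𝓑}) (A := A)
    (D := m ^ m * 𝓑.card) (fun _ _ _ => mem_univ _) (fun T hT => by
      have hsub : (fiber {T : ι → Fin n | A.image T ∈ 𝓑} A T).image (fun F => A.image F) ⊆ 𝓑 := by
        intro f hf
        obtain ⟨F, hF, rfl⟩ := mem_image.1 hf
        rw [mem_fiber, mem_filter] at hF
        exact hF.1.2
      refine (card_le_mul_card_image _ (m ^ m) fun f hf => ?_).trans
        (Nat.mul_le_mul_left _ (card_le_card hsub))
      have hfm := h𝓑 f (hsub hf)
      have : (Fintype.piFinset fun i => if i ∈ A then f else {T i}).card = m ^ m := by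
        rw [Fintype.card_piFinset, ← prod_subset (subset_univ A)]
        · rw [prod_congr rfl fun i hi => by rw [if_pos hi, hfm], prod_const, hA]
        · intro i _ hi
          rw [if_neg hi, card_singleton]
      rw [← this]
      refine card_le_card fun F hF => Fintype.mem_piFinset.2 fun i => ?_
      rw [mem_filter, mem_fiber] at hF
      split_ifs with hi
      · rw [← hF.2]; exact mem_image_of_mem _ hi
      · rw [hF.1.2 i hi]; exact mem_singleton_self _)
  rwa [card_univ, Fintype.card_fin, hA] at h

open Classical in
theorem card_bad_tuples_le (c : Finset (Fin n) → Finset (Fin n)) (hc : ∀ f, Disjoint (c f) f)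
    (t m : ℕ) {Good : (ι → Fin n) → Prop} (hGood : ∀ T, (Function.Injective T ∧
      ∀ f ⊆ univ.image T, f.card = m → (c f).card = t ∧ Disjoint (c f) (univ.image T)) → Good T) :
    ({T : ι → Fin n | ¬ Good T} : Finset (ι → Fin n)).card ≤
      (Fintype.card ι ^ 2 + 2 ^ Fintype.card ι * Fintype.card ι * t) *
        n ^ (Fintype.card ι - 1) + 2 ^ Fintype.card ι * (m ^ m *
        ({f ∈ powersetCard m (univ : Finset (Fin n)) | (c f).card ≠ t}).card *
          n ^ (Fintype.card ι - m)) := by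
  set 𝓑 := {f ∈ powersetCard m (univ : Finset (Fin n)) | (c f).card ≠ t} with h𝓑
  have hsub : ({T : ι → Fin n | ¬ Good T} : Finset (ι → Fin n)) ⊆
      ((univ.offDiag.biUnion fun p : ι × ι => {T : ι → Fin n | T p.1 = T p.2}) ∪
      ((univ.filter fun p : Finset ι × ι => p.2 ∉ p.1).biUnion fun p => {T : ι → Fin n |
        (c (p.1.image T)).card = t ∧ T p.2 ∈ c (p.1.image T)})) ∪
      ((univ.filter fun A : Finset ι => A.card = m).biUnion fun A =>
        {T : ι → Fin n | A.image T ∈ 𝓑}) := by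
    intro T hT
    simp only [mem_filter, mem_univ, true_and] at hT
    by_contra hn
    simp only [mem_union, mem_biUnion, mem_filter, mem_univ, true_and, mem_offDiag, not_or,
      not_exists, not_and, Prod.forall] at hn
    obtain ⟨⟨h1, h2⟩, h3⟩ := hn
    have hinj : Function.Injective T := fun i j hij => by
      by_contra h
      exact h1 i j h hij
    refine hT (hGood T ⟨hinj, fun f hf hfm => ?_⟩)
    obtain ⟨A, -, rfl⟩ := subset_image_iff.1 hf
    rw [card_image_of_injective _ hinj] at hfm
    have hct : (c (A.image T)).card = t := by
      by_contra h
      refine h3 A hfm (mem_filter.2 ⟨mem_powersetCard.2 ⟨subset_univ _, ?_⟩, h⟩)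
      rw [card_image_of_injective _ hinj, hfm]
    refine ⟨hct, disjoint_left.2 fun x hx hxT => ?_⟩
    obtain ⟨j, -, rfl⟩ := mem_image.1 hxT
    refine h2 A j (fun hj => ?_) hct hx
    exact disjoint_left.1 (hc _) hx (mem_image_of_mem _ hj)
  refine (card_le_card hsub).trans ((card_union_le _ _).trans (add_le_add
    ((card_union_le _ _).trans ?_) ?_))
  · rw [add_mul]
    refine add_le_add ?_ ?_
    · refine (card_biUnion_le_card_mul _ _ (n ^ (Fintype.card ι - 1)) fun p hp =>
        card_tuples_eq_le (mem_offDiag.1 hp).2.2).trans (Nat.mul_le_mul_right _ ?_)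
      rw [offDiag_card, card_univ, sq]
      exact Nat.sub_le _ _
    · refine (card_biUnion_le_card_mul _ _ (t * n ^ (Fintype.card ι - 1)) fun p hp =>
        card_tuples_mem_le c t (mem_filter.1 hp).2).trans ?_
      rw [mul_assoc (2 ^ Fintype.card ι * Fintype.card ι)]
      refine Nat.mul_le_mul_right _ ((card_le_univ _).trans ?_)
      rw [Fintype.card_prod, Fintype.card_finset]
  · refine (card_biUnion_le_card_mul _ _ _ fun A hA => card_tuples_image_mem_le m 𝓑
      (fun f hf => (mem_powersetCard.1 (mem_filter.1 hf).1).2) (mem_filter.1 hA).2).trans ?_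
    refine Nat.mul_le_mul_right _ ((card_le_univ _).trans ?_)
    rw [Fintype.card_finset]

end badTuples

/-- In an extremal hypergraph almost all `(k-1)`-sets have the same `t` centers. -/
theorem exists_mul_card_centers_ne_le {k t : ℕ} (hk : 4 ≤ k) (ht : 2 ≤ t) (q : ℕ) :
    ∃ D n₀, 2 * (2 * t + 1) * k < D ∧ ∀ n ≥ n₀, ∀ H : Finset (Finset (Fin n)),
      (∀ e ∈ H, e.card = k) → CycleFree k t H → H.card = n.choose k - (n - t).choose k →
      ∃ S : Finset (Fin n), S.card = t ∧ q * ({f ∈ powersetCard (k - 1) (univ : Finset (Fin n)) |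
        centers H D f ≠ S}).card ≤ n ^ (k - 1) := by
  classical
  obtain ⟨m, rfl⟩ : ∃ m, k = m + 1 := ⟨k - 1, by omega⟩
  simp only [Nat.add_sub_cancel]
  obtain ⟨s, hs⟩ : ∃ s, s = t + 2 := ⟨_, rfl⟩
  obtain ⟨r, hr0⟩ : ∃ r, r = m + (m + s) := ⟨_, rfl⟩
  have hr : Fintype.card (Fin m ⊕ (Fin m ⊕ Fin s)) = r := by simp [hr0]
  obtain ⟨a, ha⟩ : ∃ a, a = r ^ 2 + 2 ^ r * r * t := ⟨_, rfl⟩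
  obtain ⟨D, n₀, hD, hmain⟩ := mul_card_centers_ne_le hk ht (2 * ((q + 2) * (2 ^ r * m ^ m)))
  refine ⟨D, n₀ + 2 * ((q + 2) * a) + 1, hD, fun n hn H hH hfree hcard => ?_⟩
  have hb := hmain n (by omega) H hH hfree hcard
  rw [Nat.add_sub_cancel] at hb
  obtain ⟨Good, hGood⟩ : ∃ Good : (Fin m ⊕ (Fin m ⊕ Fin s) → Fin n) → Prop, ∀ T, Good T ↔
      (Function.Injective T ∧ ∀ f ⊆ univ.image T, f.card = m →
      (centers H D f).card = t ∧ Disjoint (centers H D f) (univ.image T)) := ⟨_, fun _ => Iff.rfl⟩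
  have hbad := card_bad_tuples_le (ι := Fin m ⊕ (Fin m ⊕ Fin s)) (centers H D)
    (fun f => disjoint_left.2 fun x hx => (mem_centers.1 hx).notMem) t m
    (fun T => (hGood T).2)
  rw [hr, ← ha] at hbad
  have hbad' : (q + 2) * ({T | ¬ Good T} : Finset (Fin m ⊕ (Fin m ⊕ Fin s) → Fin n)).card ≤
      n ^ r := by
    refine mul_le_of_le_add_parts hbad ?_ ?_
    · calc 2 * ((q + 2) * (a * n ^ (r - 1))) = 2 * ((q + 2) * a) * n ^ (r - 1) := by ring
        _ ≤ n * n ^ (r - 1) := Nat.mul_le_mul_right _ (by omega)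
        _ = n ^ r := by rw [← pow_succ', show r - 1 + 1 = r by omega]
    · refine le_trans (le_of_eq ?_) ((Nat.mul_le_mul_right (n ^ (r - m)) hb).trans_eq ?_)
      · ring
      · rw [← pow_add, show m + (r - m) = r by omega]
  -- the first block with the fewest bad extensions
  obtain ⟨u, hu⟩ : ∃ u : Fin m → Fin n, (q + 2) * ({T | ¬ Good T ∧ T ∘ Sum.inl = u} :
      Finset (Fin m ⊕ (Fin m ⊕ Fin s) → Fin n)).card ≤ n ^ (m + s) := by
    by_contra! hcon
    have : ∑ u : Fin m → Fin n, n ^ (m + s) < ∑ u : Fin m → Fin n, (q + 2) *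
        ({T | ¬ Good T ∧ T ∘ Sum.inl = u} : Finset (Fin m ⊕ (Fin m ⊕ Fin s) → Fin n)).card :=
      sum_lt_sum_of_nonempty ⟨fun _ => ⟨0, by omega⟩, mem_univ _⟩ fun u _ => hcon u
    rw [← mul_sum, sum_const, card_univ, Fintype.card_fun, Fintype.card_fin, Fintype.card_fin,
      smul_eq_mul, ← pow_add, ← hr0] at this
    refine absurd hbad' (not_le.2 (this.trans_eq ?_))
    congr 1
    rw [card_eq_sum_card_fiberwise (f := fun T => T ∘ Sum.inl) (t := univ) (by simp)]
    refine sum_congr rfl fun u _ => ?_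
    rw [filter_filter]
  have hnpos : 0 < n ^ (m + s) := Nat.pow_pos (by omega)
  let mk : (Fin m → Fin n) × (Fin s → Fin n) → Fin m ⊕ (Fin m ⊕ Fin s) → Fin n :=
    fun p => Sum.elim u (Sum.elim p.1 p.2)
  have hmk : Function.Injective mk := by
    intro p p' h
    refine Prod.ext (funext fun i => ?_) (funext fun i => ?_)
    · exact congrFun h (Sum.inr (Sum.inl i))
    · exact congrFun h (Sum.inr (Sum.inr i))
  have hmkbad : ∀ P : Finset ((Fin m → Fin n) × (Fin s → Fin n)), (∀ p ∈ P, ¬ Good (mk p)) →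
      (q + 2) * P.card ≤ n ^ (m + s) := by
    intro P hP
    refine le_trans (Nat.mul_le_mul_left _ (card_le_card_of_injOn mk (fun p hp => ?_)
      (hmk.injOn))) hu
    rw [mem_coe, mem_filter]
    exact ⟨mem_univ _, hP p hp, rfl⟩
  have himl : ∀ p, univ.image u ⊆ univ.image (mk p) := by
    intro p v hv
    obtain ⟨i, -, rfl⟩ := mem_image.1 hv
    exact mem_image.2 ⟨Sum.inl i, mem_univ _, rfl⟩
  have himr : ∀ p, univ.image p.1 ⊆ univ.image (mk p) := by
    intro p v hv
    obtain ⟨i, -, rfl⟩ := mem_image.1 hv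
    exact mem_image.2 ⟨Sum.inr (Sum.inl i), mem_univ _, rfl⟩
  have hucard : ∀ p, Good (mk p) → (univ.image u).card = m := by
    intro p hp
    rw [card_image_of_injective, card_univ, Fintype.card_fin]
    exact ((hGood _).1 hp).1.comp Sum.inl_injective
  obtain ⟨p₀, hp₀⟩ : ∃ p, Good (mk p) := by
    by_contra! hcon
    have := hmkbad univ fun p _ => hcon p
    rw [card_univ, Fintype.card_prod, Fintype.card_fun, Fintype.card_fun, Fintype.card_fin,
      Fintype.card_fin, Fintype.card_fin, ← pow_add] at this
    nlinarith
  refine ⟨centers H D (univ.image u), (((hGood _).1 hp₀).2 _ (himl p₀) (hucard p₀ hp₀)).1, ?_⟩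
  have hen : ∀ f : Finset (Fin n), ∃ e : Fin m → Fin n, f.card = m → univ.image e = f := by
    intro f
    by_cases hf : f.card = m
    · refine ⟨f.orderEmbOfFin hf, fun _ => ?_⟩
      ext v
      simp
    · exact ⟨u, fun h => absurd h hf⟩
  choose e he using hen
  have hfin := hmkbad (({f ∈ powersetCard m (univ : Finset (Fin n)) |
    centers H D f ≠ centers H D (univ.image u)}.image e) ×ˢ univ) (by
    intro p hp hgood0
    have hgood := (hGood _).1 hgood0
    obtain ⟨f, hf, hfp⟩ := mem_image.1 (mem_product.1 hp).1
    rw [mem_filter, mem_powersetCard] at hf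
    have hpf : univ.image p.1 = f := by rw [← hfp, he f hf.1.2]
    refine hf.2 (centers_eq_of_subset hk ht hD hH hfree (W := univ.image (mk p)) ?_ ?_ ?_ hf.1.2
      (himl p) (hucard p hgood0))
    · rw [card_image_of_injective _ hgood.1, card_univ, hr]
      omega
    · exact hgood.2
    · rw [← hpf]; exact himr p)
  rw [card_product, card_image_of_injOn, card_univ, Fintype.card_fun, Fintype.card_fin,
    Fintype.card_fin, pow_add, ← mul_assoc] at hfin
  · have := Nat.le_of_mul_le_mul_right hfin (Nat.pow_pos (by omega))
    exact le_trans (Nat.mul_le_mul_right _ (by omega)) this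
  · intro f hf g hg h
    rw [mem_coe, mem_filter, mem_powersetCard] at hf hg
    rw [← he f hf.1.2, ← he g hg.1.2, h]

section missing
variable {n k t : ℕ}

theorem card_powersetCard_not_disjoint (S : Finset (Fin n)) (k : ℕ) :
    ({e ∈ powersetCard k (univ : Finset (Fin n)) | ¬ Disjoint e S}).card =
      n.choose k - (n - S.card).choose k := by
  have h := card_filter_add_card_filter_not (s := powersetCard k (univ : Finset (Fin n)))
    (fun e => Disjoint e S)
  have h2 : {e ∈ powersetCard k (univ : Finset (Fin n)) | Disjoint e S} = powersetCard k Sᶜ := by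
    ext e
    rw [mem_filter, mem_powersetCard, mem_powersetCard, subset_compl_iff_disjoint_right]
    simp [and_comm]
  rw [h2, card_powersetCard, card_powersetCard, card_compl, card_univ, Fintype.card_fin] at h
  omega

/-- The `k`-sets meeting `S` which are not in `H`. -/
def missing (H : Finset (Finset (Fin n))) (k : ℕ) (S : Finset (Fin n)) : Finset (Finset (Fin n)) :=
  {e ∈ powersetCard k (univ : Finset (Fin n)) | ¬ Disjoint e S ∧ e ∉ H}

theorem mem_missing {H : Finset (Finset (Fin n))} {S e : Finset (Fin n)} :
    e ∈ missing H k S ↔ e.card = k ∧ ¬ Disjoint e S ∧ e ∉ H := by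
  simp [missing, mem_powersetCard]

theorem card_missing {H : Finset (Finset (Fin n))} (hH : ∀ e ∈ H, e.card = k)
    {S : Finset (Fin n)} (hcard : H.card = n.choose k - (n - S.card).choose k) :
    ({e ∈ H | Disjoint e S}).card = (missing H k S).card := by
  have h1 := card_filter_add_card_filter_not (s := H) (fun e => Disjoint e S)
  have h2 := card_powersetCard_not_disjoint S k
  have h3 := card_filter_add_card_filter_not
    (s := {e ∈ powersetCard k (univ : Finset (Fin n)) | ¬ Disjoint e S}) (fun e => e ∈ H)
  have h4 : {e ∈ {e ∈ powersetCard k (univ : Finset (Fin n)) | ¬ Disjoint e S} | e ∈ H} =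
      {e ∈ H | ¬ Disjoint e S} := by
    ext e
    simp only [mem_filter, mem_powersetCard, subset_univ, true_and]
    exact ⟨fun h => ⟨h.2, h.1.2⟩, fun h => ⟨⟨hH e h.1, h.2⟩, h.1⟩⟩
  have h5 : {e ∈ {e ∈ powersetCard k (univ : Finset (Fin n)) | ¬ Disjoint e S} | e ∉ H} =
      missing H k S := by
    rw [missing, filter_filter]
  rw [h4, h5] at h3
  omega

theorem card_missing_le {H : Finset (Finset (Fin n))} {S : Finset (Fin n)} (D : ℕ) :
    (missing H k S).card ≤ S.card *
      ({f ∈ powersetCard (k - 1) (univ : Finset (Fin n)) | centers H D f ≠ S}).card := by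
  classical
  have hex : ∀ e : Finset (Fin n), ∃ x : Fin n → Fin n, e ∈ missing H k S →
      ∀ y, x y ∈ e ∧ x y ∈ S := by
    intro e
    by_cases h : e ∈ missing H k S
    · obtain ⟨x, hx, hxS⟩ := not_disjoint_iff.1 (mem_missing.1 h).2.1
      exact ⟨fun _ => x, fun _ _ => ⟨hx, hxS⟩⟩
    · exact ⟨id, fun h' => absurd h' h⟩
  rw [← card_product]
  rcases (missing H k S).eq_empty_or_nonempty with h0 | ⟨e₀, he₀⟩
  · simp [h0]
  obtain ⟨x₀, -, -⟩ := not_disjoint_iff.1 (mem_missing.1 he₀).2.1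
  choose x hx using hex
  refine card_le_card_of_injOn (fun e => (x e x₀, e.erase (x e x₀))) (fun e he => ?_) ?_
  · rw [mem_coe] at he
    obtain ⟨h1, h2⟩ := hx e he x₀
    obtain ⟨h3, -, h5⟩ := mem_missing.1 he
    refine mem_coe.2 (mem_product.2 ⟨h2, mem_filter.2 ⟨mem_powersetCard.2 ⟨subset_univ _, ?_⟩,
      fun hc => h5 ?_⟩⟩)
    · rw [card_erase_of_mem h1, h3]
    · have : x e x₀ ∈ centers H D (e.erase (x e x₀)) := by rw [hc]; exact h2
      have := (mem_centers.1 this).insert_mem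
      rwa [insert_erase h1] at this
  · intro e he f hf h
    rw [Prod.mk.injEq] at h
    rw [← insert_erase (hx e he x₀).1, ← insert_erase (hx f hf x₀).1, h.2, h.1]

open Classical in
/-- The vertices outside `S` which fail to form a kernel with some vertex of `S`. -/
noncomputable def badVertices (H : Finset (Finset (Fin n))) (K : ℕ) (S : Finset (Fin n)) :
    Finset (Fin n) :=
  {w | w ∉ S ∧ ∃ x ∈ S, ¬ IsKernel H K {x, w}}

theorem mem_badVertices {H : Finset (Finset (Fin n))} {K : ℕ} {S : Finset (Fin n)} {w : Fin n} :
    w ∈ badVertices H K S ↔ w ∉ S ∧ ∃ x ∈ S, ¬ IsKernel H K {x, w} := by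
  simp [badVertices]

theorem isKernel_of_notMem_badVertices {H : Finset (Finset (Fin n))} {K : ℕ}
    {S : Finset (Fin n)} {x w : Fin n} (hx : x ∈ S) (hw : w ∉ S) (hb : w ∉ badVertices H K S) :
    IsKernel H K {x, w} := by
  by_contra h
  exact hb (mem_badVertices.2 ⟨hw, x, hx, h⟩)

theorem choose_le_card_missing_mem (hk : 2 ≤ k) {H : Finset (Finset (Fin n))} {K : ℕ}
    {S : Finset (Fin n)} {w : Fin n} (hw : w ∈ badVertices H K S) :
    (n - (K + 2)).choose (k - 2) ≤ ({e ∈ missing H k S | w ∈ e}).card := by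
  obtain ⟨hwS, x, hx, hker⟩ := mem_badVertices.1 hw
  simp only [IsKernel, not_forall, not_exists, not_and] at hker
  obtain ⟨W, hW, hd, hno⟩ := hker
  have hxw : x ≠ w := by rintro rfl; exact hwS hx
  have hcard : n - (K + 2) ≤ ((W ∪ {x, w})ᶜ).card := by
    rw [card_compl, Fintype.card_fin]
    have h1 := card_union_le W {x, w}
    rw [card_pair hxw] at h1
    omega
  refine (Nat.choose_le_choose (k - 2) hcard).trans ?_
  rw [← card_powersetCard]
  have hdis : ∀ g ∈ powersetCard (k - 2) (W ∪ {x, w})ᶜ, Disjoint g W ∧ Disjoint g {x, w} := by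
    intro g hg
    rw [mem_powersetCard, subset_compl_iff_disjoint_right, disjoint_union_right] at hg
    exact hg.1
  refine card_le_card_of_injOn (fun g => g ∪ {x, w}) (fun g hg => ?_) ?_
  · have hg' := hdis g hg
    rw [mem_coe, mem_powersetCard] at hg
    rw [mem_coe, mem_filter, mem_missing]
    refine ⟨⟨?_, ?_, fun hmem => ?_⟩, by simp⟩
    · rw [card_union_of_disjoint hg'.2, hg.2, card_pair hxw]; omega
    · exact not_disjoint_iff.2 ⟨x, by simp, hx⟩
    · exact hno _ hmem subset_union_right (disjoint_union_left.2 ⟨hg'.1, hd.symm⟩)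
  · intro g hg g' hg' h
    rw [← union_sdiff_cancel_right (hdis g hg).2, ← union_sdiff_cancel_right (hdis g' hg').2]
    exact congrArg (· \ {x, w}) h

theorem card_badVertices_mul_choose_le (hk : 2 ≤ k) (H : Finset (Finset (Fin n))) (K : ℕ)
    (S : Finset (Fin n)) :
    (badVertices H K S).card * (n - (K + 2)).choose (k - 2) ≤ k * (missing H k S).card := by
  calc _ = ∑ w ∈ badVertices H K S, (n - (K + 2)).choose (k - 2) := by
        rw [sum_const, smul_eq_mul]
    _ ≤ ∑ w ∈ badVertices H K S, ({e ∈ missing H k S | w ∈ e}).card :=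
        sum_le_sum fun w hw => choose_le_card_missing_mem hk hw
    _ ≤ ∑ w, ({e ∈ missing H k S | w ∈ e}).card :=
        sum_le_sum_of_subset (subset_univ _)
    _ = ∑ e ∈ missing H k S, e.card := by
        rw [sum_congr rfl fun e _ => card_eq_sum_ones e]
        simp only [card_filter]
        rw [sum_comm]
        simp
    _ = k * (missing H k S).card := by
        rw [sum_congr rfl fun e he => (mem_missing.1 he).1, sum_const, smul_eq_mul, mul_comm]

theorem pow_le_mul_choose_sub (r a : ℕ) (hn : 2 * (a + r) ≤ n) :
    n ^ r ≤ 2 ^ r * r.factorial * (n - a).choose r := by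
  have h := Nat.pow_sub_le_descFactorial (n - a) r
  rw [Nat.descFactorial_eq_factorial_mul_choose] at h
  calc n ^ r ≤ (2 * (n - a + 1 - r)) ^ r := Nat.pow_le_pow_left (by omega) _
    _ = 2 ^ r * (n - a + 1 - r) ^ r := mul_pow _ _ _
    _ ≤ 2 ^ r * (r.factorial * (n - a).choose r) := Nat.mul_le_mul_left _ h
    _ = _ := (mul_assoc _ _ _).symm

end missing

theorem card_sdiff_le_one_of_kernels {k t n : ℕ} (ht : 2 ≤ t) {H : Finset (Finset (Fin n))}
    (hH : ∀ e ∈ H, e.card = k) (hfree : CycleFree k t H) {S B : Finset (Fin n)} (hS : S.card = t)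
    (hker : ∀ x ∈ S, ∀ w ∉ S, w ∉ B → IsKernel H (2 * (2 * t + 1) * k) {x, w})
    (hn : 2 * t + k + B.card < n) {e : Finset (Fin n)} (he : e ∈ H) (heS : Disjoint e S) :
    (e \ B).card ≤ 1 := by
  by_contra! hlt
  obtain ⟨p, hp, p', hp', hne⟩ := one_lt_card.1 hlt
  rw [mem_sdiff] at hp hp'
  have hT : t < ((S ∪ B ∪ e)ᶜ).card := by
    have h1 := card_union_le (S ∪ B) e
    have h2 := card_union_le S B
    rw [hH e he] at h1
    rw [card_compl, Fintype.card_fin]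
    omega
  obtain ⟨w, hw, hw'⟩ := exists_distinct_reps (fun _ => (S ∪ B ∪ e)ᶜ) t fun _ _ => hT
  obtain ⟨x, hx, hx'⟩ := exists_distinct_reps (fun _ => S) (t - 1) fun _ _ => by omega
  have hw2 : ∀ i ≤ t, w i ∉ S ∧ w i ∉ B ∧ w i ∉ e := by
    intro i hi
    have := hw i hi
    simp only [mem_compl, mem_union, not_or] at this
    exact ⟨this.1.1, this.1.2, this.2⟩
  let y : ℕ → Fin n := fun i => if i = 0 then p else if i = t then p' else w i
  have hyout : ∀ i ≤ t, y i ∉ S ∧ y i ∉ B := by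
    intro i hi
    simp only [y]
    split_ifs
    · exact ⟨disjoint_left.1 heS hp.1, hp.2⟩
    · exact ⟨disjoint_left.1 heS hp'.1, hp'.2⟩
    · exact ⟨(hw2 i hi).1, (hw2 i hi).2.1⟩
  have hxS : ∀ i < t, x i ∈ S := fun i hi => hx i (by omega)
  have hy : ∀ i ≤ t, ∀ j < i, y i ≠ y j := by
    intro i hi j hj
    have hj2 := hw2 j (by omega)
    have hi2 := hw2 i hi
    have hij := hw' i hi j hj
    simp only [y]
    rw [if_neg (show i ≠ 0 by omega), if_neg (show j ≠ t by omega)]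
    split_ifs
    · exact hne.symm
    · exact fun h => hj2.2.2 (h ▸ hp'.1)
    · exact fun h => hi2.2.2 (h ▸ hp.1)
    · exact hij
  refine not_cycleFree_of_seq ht hH le_rfl x y (fun i hi => hx' i (by omega)) hy
    (fun i hi j hj h => (hyout j hj).1 (h ▸ hxS i hi))
    (fun i hi => ⟨hker _ (hxS i hi) _ (hyout i hi.le).1 (hyout i hi.le).2,
      hker _ (hxS i hi) _ (hyout (i + 1) hi).1 (hyout (i + 1) hi).2⟩) he ?_ ?_
    (fun i hi h => disjoint_left.1 heS h (hxS i hi)) ?_ hfree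
  · simpa [y] using hp.1
  · simpa [y, show t ≠ 0 by omega] using hp'.1
  · intro i hi h0
    simp only [y]
    rw [if_neg (by omega), if_neg (by omega)]
    exact (hw2 i hi.le).2.2

theorem card_edges_subset_le {k t : ℕ} (hk : 4 ≤ k) (ht : 2 ≤ t) :
    ∃ C : ℕ, ∀ (n : ℕ) (H : Finset (Finset (Fin n))), (∀ e ∈ H, e.card = k) → CycleFree k t H →
      ∀ B : Finset (Fin n), ({e ∈ H | e ⊆ B}).card ≤ C * B.card ^ (k - 1) := by
  refine ⟨(k + 1) ^ (k + 0) * ((2 * (2 * t + 1) * k + 1) * k), fun n H hH hfree B => ?_⟩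
  by_contra! hlt
  obtain ⟨𝓕, hp, him, -, hc⟩ := exists_partite (m := k) (d := 0) (by omega)
    (H := {e ∈ H | e ⊆ B}) (fun e he => hH e (mem_filter.1 he).1) (fun _ => ∅) (by simp)
  have hB : ∀ F ∈ 𝓕, ∀ i, F i ∈ B := fun F hF i =>
    (mem_filter.1 (him F hF)).2 (mem_image_of_mem _ (mem_univ i))
  have hc2 : (2 * (2 * t + 1) * k + 1) * k * B.card ^ (k - 1) < 𝓕.card := by
    rw [mul_assoc] at hlt
    exact lt_of_mul_lt_mul_left (hlt.trans_le hc) (Nat.zero_le _)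
  obtain ⟨𝓖, hsub, hne, hmov⟩ := exists_movable_subfamily hB hc2
  let i0 : Fin k := ⟨0, by omega⟩
  let i1 : Fin k := ⟨1, by omega⟩
  let i2 : Fin k := ⟨2, by omega⟩
  have h01 : i0 ≠ i1 := by simp [i0, i1]
  have h02 : i0 ≠ i2 := by simp [i0, i2]
  have h12 : i1 ≠ i2 := by simp [i1, i2]
  refine not_cycleFree_of_zigzag ht hH (hp.mono hsub) hne
    (fun F hF => (mem_filter.1 (him F (hsub hF))).1) (α := {i0}) (β := {i1}) (μ := {i2}) (U := {i2})
    (singleton_nonempty _) (singleton_nonempty _) (singleton_nonempty _) ?_ ?_ ?_ Subset.rfl ?_ ?_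
    (hmov _) (hmov _) (hmov _) (Nat.lt_succ_self _) hfree <;>
    simp [h01, h02, h12, h02.symm, h12.symm]

theorem not_cycleFree_of_three_edges {k t n : ℕ} (ht : 2 ≤ t) {H : Finset (Finset (Fin n))}
    (hH : ∀ e ∈ H, e.card = k) {s : ℕ} (hs : 2 * t = s + 2) (z : ℕ → Fin n)
    (hz : ∀ i ≤ s, ∀ j < i, z i ≠ z j)
    (hker : ∀ i < s, IsKernel H (2 * (2 * t + 1) * k) {z i, z (i + 1)}) {E F G : Finset (Fin n)}
    (hE : E ∈ H) (hF : F ∈ H) (hG : G ∈ H) (hEG : Disjoint E G) (hEF : (E ∩ F).Nonempty)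
    (hFG : (F ∩ G).Nonempty) (h0 : z 0 ∈ E) (hzs : z s ∈ G) (hzF : ∀ i ≤ s, z i ∉ F)
    (hzE : ∀ i ≤ s, 0 < i → z i ∉ E) (hzG : ∀ i < s, z i ∉ G) : ¬ CycleFree k t H := by
  let U : ℕ → Finset (Fin n) := fun i =>
    if i < s then {z i, z (i + 1)} else if i = s then G else if i = s + 1 then F else E
  have hUlt : ∀ i < s, U i = {z i, z (i + 1)} := fun i hi => if_pos hi
  have hUs : U s = G := by simp [U]
  have hUs1 : U (s + 1) = F := by simp [U]
  have hUs2 : U (s + 2) = E := by simp [U]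
  have hcases : ∀ i < 2 * t + 1, i < s ∨ i = s ∨ i = s + 1 ∨ i = s + 2 := fun i hi => by omega
  refine not_not.2 (exists_minimalCycle_of_kernels (by omega) hH le_rfl U ?_ ?_ ?_ ?_)
  · intro i hi
    rcases hcases i hi with h | rfl | rfl | rfl
    · rw [hUlt i h]; exact hker i h
    · rw [hUs]; exact isKernel_of_mem hG
    · rw [hUs1]; exact isKernel_of_mem hF
    · rw [hUs2]; exact isKernel_of_mem hE
  · intro i hi
    rcases hcases i (by omega) with h | rfl | rfl | rfl
    · rw [hUlt i h]
      rcases Nat.lt_or_ge (i + 1) s with h' | h'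
      · rw [hUlt _ h']; exact ⟨z (i + 1), by simp⟩
      · obtain rfl : i + 1 = s := by omega
        rw [hUs]; exact ⟨z (i + 1), by simp [hzs]⟩
    · rw [hUs, hUs1, inter_comm]; exact hFG
    · rw [hUs1, hUs2, inter_comm]; exact hEF
    · omega
  · rw [show 2 * t + 1 - 1 = s + 2 by omega, hUs2, hUlt 0 (by omega)]
    exact ⟨z 0, by simp [h0]⟩
  · intro i j hij hj hne
    rcases hcases j hj with h | rfl | rfl | rfl
    · rw [hUlt i (by omega), hUlt j h]
      have h1 := hz j (by omega) i (by omega)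
      have h2 := hz j (by omega) (i + 1) (by omega)
      have h3 := hz (j + 1) (by omega) i (by omega)
      have h4 := hz (j + 1) (by omega) (i + 1) (by omega)
      simp [h1, h2, h3, h4]
    · rw [hUlt i (by omega), hUs]
      simp [hzG i (by omega), hzG (i + 1) (by omega)]
    · rw [hUlt i (by omega), hUs1]
      simp [hzF i (by omega), hzF (i + 1) (by omega)]
    · rcases Nat.lt_or_ge i s with h' | h'
      · rw [hUlt i h', hUs2]
        simp [hzE i (by omega) (by omega), hzE (i + 1) (by omega) (by omega)]
      · obtain rfl : i = s := by omega
        rw [hUs, hUs2]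
        exact hEG.symm

theorem card_heavy_le {k t : ℕ} (hk : 4 ≤ k) (ht : 2 ≤ t) :
    ∃ C : ℕ, ∀ (n : ℕ) (H : Finset (Finset (Fin n))), (∀ e ∈ H, e.card = k) → CycleFree k t H →
      ∀ S B : Finset (Fin n), S.card = t → Disjoint B S →
      (∀ x ∈ S, ∀ w ∉ S, w ∉ B → IsKernel H (2 * (2 * t + 1) * k) {x, w}) →
      2 * t + k + B.card < n →
      ({g ∈ powersetCard (k - 1) B |
        3 ≤ ({u | u ∉ B ∧ u ∉ S ∧ insert u g ∈ H} : Finset (Fin n)).card}).card ≤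
        C * B.card ^ (k - 2) := by
  obtain ⟨m, rfl⟩ : ∃ m, k = m + 1 := ⟨k - 1, by omega⟩
  rw [Nat.add_sub_cancel, show m + 1 - 2 = m - 1 by omega]
  refine ⟨(m + 1) ^ (m + 0) * ((2 * m + 1) * m), fun n H hH hfree S B hS hBS hker hn => ?_⟩
  by_contra! hlt
  obtain ⟨𝓕, hp, him, -, hc⟩ := exists_partite (m := m) (d := 0) (by omega)
    (H := {g ∈ powersetCard m B |
      3 ≤ ({u | u ∉ B ∧ u ∉ S ∧ insert u g ∈ H} : Finset (Fin n)).card})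
    (fun e he => (mem_powersetCard.1 (mem_filter.1 he).1).2) (fun _ => ∅) (by simp)
  have hsubB : ∀ F ∈ 𝓕, univ.image F ⊆ B := fun F hF =>
    (mem_powersetCard.1 (mem_filter.1 (him F hF)).1).1
  have hdeg : ∀ F ∈ 𝓕, 3 ≤
      ({u | u ∉ B ∧ u ∉ S ∧ insert u (univ.image F) ∈ H} : Finset (Fin n)).card :=
    fun F hF => (mem_filter.1 (him F hF)).2
  have hc2 : (2 * m + 1) * m * B.card ^ (m - 1) < 𝓕.card := by
    rw [mul_assoc] at hlt
    exact lt_of_mul_lt_mul_left (hlt.trans_le hc) (Nat.zero_le _)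
  obtain ⟨𝓖, hsub, ⟨f, hf⟩, hmov⟩ := exists_movable_subfamily
    (fun F hF i => hsubB F hF (mem_image_of_mem _ (mem_univ i))) hc2
  have hp' := hp.mono hsub
  have hcard : ∀ F ∈ 𝓖, (univ.image F).card = m := fun F hF =>
    (mem_powersetCard.1 (mem_filter.1 (him F (hsub hF))).1).2
  let i0 : Fin m := ⟨0, by omega⟩
  let i1 : Fin m := ⟨1, by omega⟩
  have h01 : i0 ≠ i1 := by simp [i0, i1]
  obtain ⟨g, hg, hg1, hg2⟩ := hmov {i0}ᶜ f hf (univ.image f) (by rw [hcard f hf]; omega)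
  obtain ⟨g', hg', hg1', hg2'⟩ := hmov {i1}ᶜ f hf (univ.image f ∪ univ.image g) (by
    have := card_union_le (univ.image f) (univ.image g)
    rw [hcard f hf, hcard g hg] at this
    omega)
  have hgg' : Disjoint (univ.image g) (univ.image g') := by
    rw [disjoint_right]
    intro v hv hvg
    obtain ⟨i, -, rfl⟩ := mem_image.1 hv
    by_cases hi : i = i1
    · subst hi
      rw [hg1' i1 (by simp)] at hvg
      obtain ⟨j, -, hj⟩ := mem_image.1 hvg
      have hji := hp' g hg f hf j i1 hj
      exact hg2 j (by simp [hji, h01.symm]) (by rw [hj]; exact mem_image_of_mem _ (mem_univ _))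
    · exact hg2' i (by simpa using hi) (mem_union_right _ hvg)
  obtain ⟨u, hu, hu'⟩ := exists_distinct_reps (fun i =>
    ({u | u ∉ B ∧ u ∉ S ∧
      insert u (univ.image (if i = 0 then g else if i = 1 then f else g')) ∈ H} :
      Finset (Fin n))) 2 (fun i _ => hdeg _ (hsub (by split_ifs <;> assumption)))
  have hu0 := hu 0 (by omega)
  have hu1 := hu 1 (by omega)
  have hu2 := hu 2 (by omega)
  simp only [mem_filter, mem_univ, true_and, if_true, one_ne_zero, if_false, OfNat.ofNat_ne_zero,
    OfNat.ofNat_ne_one] at hu0 hu1 hu2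
  have hu10 := hu' 1 (by omega) 0 (by omega)
  have hu20 := hu' 2 (by omega) 0 (by omega)
  have hu21 := hu' 2 (by omega) 1 (by omega)
  generalize u 0 = a at *
  generalize u 1 = b at *
  generalize u 2 = c at *
  have hT : t < ((S ∪ B ∪ {a, b, c})ᶜ).card := by
    have h1 := card_union_le (S ∪ B) {a, b, c}
    have h2 := card_union_le S B
    have h3 := card_le_three (a := a) (b := b) (c := c)
    rw [card_compl, Fintype.card_fin]
    omega
  obtain ⟨w, hw, hw'⟩ := exists_distinct_reps (fun _ => (S ∪ B ∪ {a, b, c})ᶜ) t fun _ _ => hT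
  obtain ⟨x, hx, hx'⟩ := exists_distinct_reps (fun _ => S) (t - 1) fun _ _ => by omega
  have hw2 : ∀ i ≤ t, w i ∉ S ∧ w i ∉ B ∧ w i ≠ a ∧ w i ≠ b ∧ w i ≠ c := by
    intro i hi
    have := hw i hi
    simp only [mem_compl, mem_union, mem_insert, mem_singleton, not_or] at this
    exact ⟨this.1.1, this.1.2, this.2⟩
  obtain ⟨s, hs⟩ : ∃ s, 2 * t = s + 2 := ⟨2 * t - 2, by omega⟩
  let z : ℕ → Fin n := fun i =>
    if i % 2 = 1 then x (i / 2) else if i = 0 then a else if i = s then c else w (i / 2)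
  have hzodd : ∀ i ≤ s, i % 2 = 1 → z i = x (i / 2) ∧ z i ∈ S := by
    intro i hi h
    have : z i = x (i / 2) := if_pos h
    exact ⟨this, this ▸ hx _ (by omega)⟩
  have hzeven : ∀ i ≤ s, i % 2 = 0 → z i ∉ S ∧ z i ∉ B := by
    intro i hi h
    simp only [z]
    rw [if_neg (by omega)]
    split_ifs
    · exact ⟨hu0.2.1, hu0.1⟩
    · exact ⟨hu2.2.1, hu2.1⟩
    · exact ⟨(hw2 _ (by omega)).1, (hw2 _ (by omega)).2.1⟩
  have hzne : ∀ i ≤ s, (z i = a → i = 0) ∧ z i ≠ b ∧ (z i = c → i = s) := by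
    intro i hi
    rcases Nat.mod_two_eq_zero_or_one i with h | h
    · have := (hw2 (i / 2) (by omega)).2.2
      simp only [z]
      rw [if_neg (by omega)]
      split_ifs with h0 h1
      · exact ⟨fun _ => h0, hu10.symm, fun h => absurd h hu20.symm⟩
      · exact ⟨fun h => absurd h hu20, hu21, fun _ => h1⟩
      · exact ⟨fun h => absurd h this.1, this.2.1, fun h => absurd h this.2.2⟩
    · have := (hzodd i hi h).2
      exact ⟨fun h => absurd (h ▸ this) hu0.2.1, fun h => hu1.2.1 (h ▸ this),
        fun h => absurd (h ▸ this) hu2.2.1⟩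
  have hzB : ∀ i ≤ s, z i ∉ B := by
    intro i hi
    rcases Nat.mod_two_eq_zero_or_one i with h | h
    · exact (hzeven i hi h).2
    · exact fun hB => disjoint_left.1 hBS hB (hzodd i hi h).2
  have hzimg : ∀ i ≤ s, ∀ F ∈ 𝓖, z i ∉ univ.image F := fun i hi F hF h =>
    hzB i hi (hsubB F (hsub hF) h)
  refine not_cycleFree_of_three_edges ht hH hs z ?_ ?_ hu0.2.2 hu1.2.2 hu2.2.2
    ?_ ?_ ?_ ?_ ?_ ?_ ?_ ?_
    hfree
  · intro i hi j hj
    rcases Nat.mod_two_eq_zero_or_one i with h | h <;>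
      rcases Nat.mod_two_eq_zero_or_one j with h' | h'
    · intro he
      by_cases hj0 : j = 0
      · have hja : z j = a := by simp [z, hj0]
        have := (hzne i hi).1 (he.trans hja)
        omega
      by_cases his : i = s
      · have hic : z i = c := by
          simp only [z]; rw [if_neg (by omega), if_neg (by omega), if_pos his]
        have := (hzne j (by omega)).2.2 (he.symm.trans hic)
        omega
      simp only [z] at he
      rw [if_neg (by omega), if_neg (by omega), if_neg his, if_neg (by omega), if_neg hj0,
        if_neg (by omega)] at he
      exact hw' (i / 2) (by omega) (j / 2) (by omega) he
    · exact fun he => (hzeven i hi h).1 (he ▸ (hzodd j (by omega) h').2)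
    · exact fun he => (hzeven j (by omega) h').1 (he ▸ (hzodd i hi h).2)
    · rw [(hzodd i hi h).1, (hzodd j (by omega) h').1]
      exact hx' _ (by omega) _ (by omega)
  · intro i hi
    rcases Nat.mod_two_eq_zero_or_one i with h | h
    · rw [pair_comm]
      have := hzeven i hi.le h
      exact hker _ (hzodd (i + 1) hi (by omega)).2 _ this.1 this.2
    · have := hzeven (i + 1) hi (by omega)
      exact hker _ (hzodd i hi.le h).2 _ this.1 this.2
  · rw [disjoint_insert_left, disjoint_insert_right, mem_insert, not_or]
    exact ⟨⟨hu20.symm, fun h => hu0.1 (hsubB g' (hsub hg') h)⟩,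
      fun h => hu2.1 (hsubB g (hsub hg) h), hgg'⟩
  · exact ⟨f i0, mem_inter.2 ⟨mem_insert_of_mem (mem_image.2 ⟨i0, mem_univ _, hg1 i0 (by simp)⟩),
      mem_insert_of_mem (mem_image_of_mem _ (mem_univ _))⟩⟩
  · exact ⟨f i1, mem_inter.2 ⟨mem_insert_of_mem (mem_image_of_mem _ (mem_univ _)),
      mem_insert_of_mem (mem_image.2 ⟨i1, mem_univ _, hg1' i1 (by simp)⟩)⟩⟩
  · simp [z]
  · have : z s = c := by
      change (if s % 2 = 1 then _ else if s = 0 then _ else if s = s then c else _) = c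
      rw [if_neg (by omega), if_neg (by omega), if_pos rfl]
    rw [this]
    exact mem_insert_self _ _
  · intro i hi h
    rcases mem_insert.1 h with h | h
    · exact (hzne i hi).2.1 h
    · exact hzimg i hi f hf h
  · intro i hi hpos h
    rcases mem_insert.1 h with h | h
    · exact hpos.ne' ((hzne i hi).1 h)
    · exact hzimg i hi g hg h
  · intro i hi h
    rcases mem_insert.1 h with h | h
    · exact hi.ne ((hzne i hi.le).2.2 h)
    · exact hzimg i hi.le g' hg' h

theorem card_disjoint_edges_le {k t : ℕ} (hk : 4 ≤ k) (ht : 2 ≤ t) :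
    ∃ C : ℕ, ∀ (n : ℕ) (H : Finset (Finset (Fin n))), (∀ e ∈ H, e.card = k) → CycleFree k t H →
      ∀ S B : Finset (Fin n), S.card = t → Disjoint B S →
      (∀ x ∈ S, ∀ w ∉ S, w ∉ B → IsKernel H (2 * (2 * t + 1) * k) {x, w}) →
      2 * t + k + B.card < n →
      ({e ∈ H | Disjoint e S}).card ≤ C * (n * B.card ^ (k - 2)) := by
  obtain ⟨C₁, h₁⟩ := card_edges_subset_le hk ht
  obtain ⟨C₂, h₂⟩ := card_heavy_le hk ht
  refine ⟨C₁ + 2 + C₂, fun n H hH hfree S B hS hBS hker hn => ?_⟩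
  have h1 := h₁ n H hH hfree B
  have h2 := h₂ n H hH hfree S B hS hBS hker hn
  let N : Finset (Fin n) → Finset (Fin n) := fun g => {u | u ∉ B ∧ u ∉ S ∧ insert u g ∈ H}
  have hsub : {e ∈ H | Disjoint e S} ⊆ {e ∈ H | e ⊆ B} ∪
      (powersetCard (k - 1) B).biUnion fun g => (N g).image fun u => insert u g := by
    intro e he
    rw [mem_filter] at he
    rcases Nat.lt_or_ge (e \ B).card 1 with h | h
    · exact mem_union_left _ (mem_filter.2 ⟨he.1, sdiff_eq_empty_iff_subset.1
        (card_eq_zero.1 (by omega))⟩)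
    · obtain ⟨u, hu⟩ := card_eq_one.1
        (h.antisymm' (card_sdiff_le_one_of_kernels ht hH hfree hS hker hn he.1 he.2))
      have hue : u ∈ e ∧ u ∉ B := mem_sdiff.1 (hu ▸ mem_singleton_self u)
      refine mem_union_right _ (mem_biUnion.2 ⟨e.erase u, mem_powersetCard.2 ⟨fun v hv => ?_, ?_⟩,
        mem_image.2 ⟨u, mem_filter.2 ⟨mem_univ _, hue.2, disjoint_left.1 he.2 hue.1, ?_⟩, ?_⟩⟩)
      · by_contra hvB
        have : v ∈ e \ B := mem_sdiff.2 ⟨mem_of_mem_erase hv, hvB⟩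
        rw [hu, mem_singleton] at this
        exact (mem_erase.1 hv).1 this
      · rw [card_erase_of_mem hue.1, hH e he.1]
      · rw [insert_erase hue.1]; exact he.1
      · exact insert_erase hue.1
  have hbn : B.card ≤ n := by simpa using card_le_univ B
  have hpow : B.card ^ (k - 1) ≤ n * B.card ^ (k - 2) := by
    rw [show k - 1 = k - 2 + 1 by omega, pow_succ']
    exact Nat.mul_le_mul_right _ hbn
  have hsum : ∑ g ∈ powersetCard (k - 1) B, (N g).card ≤
      2 * B.card ^ (k - 1) + n * (C₂ * B.card ^ (k - 2)) := by
    calc _ ≤ ∑ g ∈ powersetCard (k - 1) B, (2 + if 3 ≤ (N g).card then n else 0) := by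
          refine sum_le_sum fun g _ => ?_
          have : (N g).card ≤ n := by simpa using card_le_univ (N g)
          split_ifs <;> omega
      _ = 2 * B.card.choose (k - 1) +
          n * ({g ∈ powersetCard (k - 1) B | 3 ≤ (N g).card}).card := by
          rw [sum_add_distrib, sum_const, card_powersetCard, ← sum_filter, sum_const, smul_eq_mul,
            smul_eq_mul, mul_comm, mul_comm n]
      _ ≤ _ := add_le_add (Nat.mul_le_mul_left _ (Nat.choose_le_pow _ _))
          (Nat.mul_le_mul_left _ h2)
  have hX := (card_le_card hsub).trans ((card_union_le _ _).trans (add_le_add h1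
    (card_biUnion_le.trans ((sum_le_sum fun g _ => card_image_le).trans hsum))))
  have e1 := Nat.mul_le_mul_left C₁ hpow
  have e2 : n * (C₂ * B.card ^ (k - 2)) = C₂ * (n * B.card ^ (k - 2)) := by ring
  rw [e2] at hX
  rw [add_mul, add_mul]
  omega

theorem exists_extremal_threshold {k t : ℕ} (hk : 4 ≤ k) (ht : 2 ≤ t) :
    ∃ n₀, ∀ n ≥ n₀, ∀ H : Finset (Finset (Fin n)), (∀ e ∈ H, e.card = k) →
      H.card = n.choose k - (n - t).choose k → CycleFree k t H →
      ∃ S : Finset (Fin n), S.card = t ∧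
        ∀ e : Finset (Fin n), e ∈ H ↔ e.card = k ∧ (e ∩ S).Nonempty := by
  obtain ⟨C, hC⟩ := card_disjoint_edges_le hk ht
  obtain ⟨r, hr, rfl⟩ : ∃ r, 1 ≤ r ∧ k = r + 3 := ⟨k - 3, by omega, by omega⟩
  obtain ⟨c, hc⟩ : ∃ c, c = 2 ^ (r + 1) * (r + 1).factorial := ⟨_, rfl⟩
  obtain ⟨K, hK⟩ : ∃ K, K = 2 * (2 * t + 1) * (r + 3) := ⟨_, rfl⟩
  obtain ⟨C₁, hC₁⟩ : ∃ C₁, C₁ = c * (r + 3) * C := ⟨_, rfl⟩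
  obtain ⟨C₂, hC₂⟩ : ∃ C₂, C₂ = c * (r + 3) * t := ⟨_, rfl⟩
  obtain ⟨D, n₀, hD, hmain⟩ := exists_mul_card_centers_ne_le hk ht (2 * (C₁ + 1) * (C₂ + 1))
  refine ⟨n₀ + 2 * (K + 2 + (r + 1)) + 2 * (2 * t + (r + 3)) + 1,
    fun n hn H hH hcard hfree => ?_⟩
  obtain ⟨S, hS, hbad⟩ := hmain n (by omega) H hH hfree hcard
  have hM := card_missing_le (k := r + 3) (H := H) (S := S) D
  have hX := card_missing hH (S := S) (by rw [hS]; exact hcard)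
  have hb := card_badVertices_mul_choose_le (k := r + 3) (by omega) H K S
  have hpow := pow_le_mul_choose_sub (n := n) (r + 1) (K + 2) (by omega)
  rw [← hc] at hpow
  rw [hS] at hM
  rw [show r + 3 - 1 = r + 2 by omega] at hM hbad
  rw [show r + 3 - 2 = r + 1 by omega] at hb
  have hBS : Disjoint (badVertices H K S) S :=
    disjoint_left.2 fun w hw => (mem_badVertices.1 hw).1
  have hX2 := hC n H hH hfree S (badVertices H K S) hS hBS
    (fun x hx w hw hwb => hK ▸ isKernel_of_notMem_badVertices hx hw hwb)
  rw [show r + 3 - 2 = r + 1 by omega, hX] at hX2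
  generalize (badVertices H K S).card = b at *
  generalize hMc : (missing H (r + 3) S).card = M at *
  generalize ({f ∈ powersetCard (r + 2) (univ : Finset (Fin n)) | centers H D f ≠ S}).card = z at *
  have hnpos : 0 < n := by omega
  have h1 : b * n ^ (r + 1) ≤ c * (r + 3) * M := by
    calc b * n ^ (r + 1) ≤ b * (c * (n - (K + 2)).choose (r + 1)) := Nat.mul_le_mul_left _ hpow
      _ = c * (b * (n - (K + 2)).choose (r + 1)) := by ring
      _ ≤ c * ((r + 3) * M) := Nat.mul_le_mul_left _ hb
      _ = _ := by ring
  have h2 : 2 * (C₁ + 1) * b ≤ n := by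
    refine Nat.le_of_mul_le_mul_left ?_ (Nat.succ_pos C₂)
    refine Nat.le_of_mul_le_mul_right ?_ (Nat.pow_pos hnpos : 0 < n ^ (r + 1))
    calc (C₂ + 1) * (2 * (C₁ + 1) * b) * n ^ (r + 1)
        = 2 * (C₁ + 1) * (C₂ + 1) * (b * n ^ (r + 1)) := by ring
      _ ≤ 2 * (C₁ + 1) * (C₂ + 1) * (c * (r + 3) * (t * z)) :=
        Nat.mul_le_mul_left _ (h1.trans (Nat.mul_le_mul_left _ hM))
      _ = C₂ * (2 * (C₁ + 1) * (C₂ + 1) * z) := by rw [hC₂]; ring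
      _ ≤ (C₂ + 1) * n ^ (r + 2) := Nat.mul_le_mul (Nat.le_succ _) hbad
      _ = (C₂ + 1) * n * n ^ (r + 1) := by ring
  have h3 : 2 * b ≤ n := le_trans (by nlinarith) h2
  have hX3 := hX2 (by omega)
  have hb0 : b = 0 := by
    by_contra hb0
    have h4 : n ^ r ≤ C₁ * b ^ r := by
      refine Nat.le_of_mul_le_mul_left ?_ (Nat.mul_pos (Nat.pos_of_ne_zero hb0) hnpos)
      calc b * n * n ^ r = b * n ^ (r + 1) := by ring
        _ ≤ c * (r + 3) * (C * (n * b ^ (r + 1))) := h1.trans (Nat.mul_le_mul_left _ hX3)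
        _ = b * n * (C₁ * b ^ r) := by rw [hC₁]; ring
    have h5 : (C₁ + 1) * b ^ r ≤ n ^ r := by
      calc (C₁ + 1) * b ^ r ≤ (C₁ + 1) ^ r * b ^ r :=
            Nat.mul_le_mul_right _ (Nat.le_self_pow (by omega) _)
        _ = ((C₁ + 1) * b) ^ r := (mul_pow _ _ _).symm
        _ ≤ n ^ r := Nat.pow_le_pow_left (le_trans (by nlinarith) h2) _
    have h6 : 0 < b ^ r := Nat.pow_pos (Nat.pos_of_ne_zero hb0)
    rw [add_mul, one_mul] at h5
    omega
  have hM0 : M = 0 := by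
    rw [hb0, zero_pow (by omega), mul_zero, mul_zero] at hX3
    omega
  subst hM0
  refine ⟨S, hS, fun e => ⟨fun he => ⟨hH e he, ?_⟩, fun ⟨hek, heS⟩ => ?_⟩⟩
  · rw [← not_disjoint_iff_nonempty_inter]
    intro hd
    rw [card_eq_zero] at hX
    exact notMem_empty e (hX ▸ mem_filter.2 ⟨he, hd⟩)
  · by_contra he
    rw [← not_disjoint_iff_nonempty_inter] at heS
    rw [card_eq_zero] at hMc
    exact notMem_empty e (hMc ▸ mem_missing.2 ⟨hek, heS, he⟩)

theorem degree_le_two_of_cycleFree_one {k n : ℕ} {H : Finset (Finset (Fin n))}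
    (hH : ∀ e ∈ H, e.card = k) (hfree : CycleFree k 1 H) (v : Fin n) :
    ({e ∈ H | v ∈ e}).card ≤ 2 := by
  by_contra! hlt
  obtain ⟨a, b, c, ha, hb, hc, hab, hac, hbc⟩ := two_lt_card_iff.1 hlt
  rw [mem_filter] at ha hb hc
  let A : Fin 3 → Finset (Fin n) := ![a, b, c]
  have hA : ∀ i, A i ∈ H ∧ v ∈ A i := by
    intro i
    fin_cases i
    exacts [ha, hb, hc]
  have hinj : Function.Injective A := by
    intro i j h
    fin_cases i <;> fin_cases j <;> simp_all [A]
  refine hfree ⟨A, ⟨hinj, fun i => hH _ (hA i).1,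
    fun i => ⟨v, mem_inter.2 ⟨(hA i).2, (hA _).2⟩⟩, fun i j h1 h2 h3 => ?_⟩, fun i => (hA i).1⟩
  exfalso
  revert i j
  decide

theorem exists_threshold_not_cycleFree_one {k : ℕ} (hk : 4 ≤ k) :
    ∃ n₀, ∀ n ≥ n₀, ∀ H : Finset (Finset (Fin n)), (∀ e ∈ H, e.card = k) →
      H.card = n.choose k - (n - 1).choose k → ¬ CycleFree k 1 H := by
  obtain ⟨r, rfl⟩ : ∃ r, k = r + 3 := ⟨k - 3, by omega⟩
  obtain ⟨c, hc⟩ : ∃ c, c = 2 ^ (r + 2) * (r + 2).factorial := ⟨_, rfl⟩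
  refine ⟨2 * (1 + (r + 2)) + c + 1, fun n hn H hH hcard hfree => ?_⟩
  have hpow := pow_le_mul_choose_sub (n := n) (r + 2) 1 (by omega)
  rw [← hc] at hpow
  have hch : H.card = (n - 1).choose (r + 2) := by
    obtain ⟨m, rfl⟩ : ∃ m, n = m + 1 := ⟨n - 1, by omega⟩
    rw [hcard, Nat.add_sub_cancel, Nat.choose_succ_succ' m (r + 2), Nat.add_sub_cancel]
  have hdeg : (r + 3) * H.card ≤ 2 * n := by
    calc (r + 3) * H.card = ∑ e ∈ H, e.card := by
          rw [sum_congr rfl hH, sum_const, smul_eq_mul, mul_comm]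
      _ = ∑ v : Fin n, ({e ∈ H | v ∈ e}).card := by
          simp only [card_filter]
          rw [sum_comm]
          simp
      _ ≤ ∑ _v : Fin n, 2 := sum_le_sum fun v _ => degree_le_two_of_cycleFree_one hH hfree v
      _ = 2 * n := by simp [mul_comm]
  have h1 : (n - 1).choose (r + 2) ≤ n := by rw [← hch]; nlinarith
  have h2 : n ^ (r + 2) ≤ c * n := hpow.trans (Nat.mul_le_mul_left _ h1)
  have h3 : n * n ≤ n ^ (r + 2) := by
    rw [← sq]
    exact Nat.pow_le_pow_right (by omega) (by omega)
  have h4 : n ≤ c := Nat.le_of_mul_le_mul_right (h3.trans h2) (by omega)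
  omega

end CycleFreeHypergraphs

/-- Theorem 2, odd case, extremal structure: for `k ≥ 4` and sufficiently large `n`, any extremal `k`-uniform hypergraph with no minimal cycle of length `2t+1` consists of all `k`-sets meeting a fixed `t`-set `S`. -/
theorem extremal_minimal_cycle_odd (k t : ℕ) (hk : 4 ≤ k) (ht : 1 ≤ t) :
    ∃ n₀ : ℕ, ∀ n ≥ n₀, ∀ H : Finset (Finset (Fin n)),
      (∀ e ∈ H, e.card = k) →
      H.card = Nat.choose n k - Nat.choose (n - t) k →
      (¬ ∃ A : ZMod (2 * t + 1) → Finset (Fin n),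
          IsMinimalCycle k (2 * t + 1) A ∧ ∀ i, A i ∈ H) →
      ∃ S : Finset (Fin n), S.card = t ∧
        ∀ e : Finset (Fin n), e ∈ H ↔ e.card = k ∧ (e ∩ S).Nonempty := by
  rcases ht.eq_or_lt with rfl | ht
  · obtain ⟨n₀, h⟩ := exists_threshold_not_cycleFree_one hk
    exact ⟨n₀, fun n hn H hH hcard hfree => absurd hfree (h n hn H hH hcard)⟩
  · exact exists_extremal_threshold hk ht
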